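/- There exist absolute constants C, C'', c, c' > 0 with the following property. Let 1 ≤ r ≤ p, θ ∈ (0,1/9], c⋆ ∈ (0,1/4], σ > 0, and n satisfy n ≥ C·max{r²/c⋆, (log n)²}·(r·log n)/(θc⋆). Let A ∈ ℝ^{p×r} satisfy AᵀA = I_r and let X be a random r×n matrix with i.i.d. BG(θ,σ²) entries. Then with probability at least 1 − c·n^{−c'}, every unit vector q̄ ∈ ℝ^p with ‖Aᵀq̄‖_∞² > c⋆ satisfying grad F(q̄) = 0 and vᵀ Hess F(q̄) v ≥ 0 for all v ⊥ q̄ obeys: min over i ∈ {1,…,r} and s ∈ {+1,−1} of ‖q̄ − s·a_i‖₂² ≤ C''·[√(r²·log n/(θn)) + (θr² + (log n)²/θ)·(r·log n)/n]. -/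

import Mathlib

open Matrix MeasureTheory ProbabilityTheory Real
open scoped BigOperators ENNReal

noncomputable section

/-- squared Euclidean norm -/
def l2sq {m : ℕ} (v : Fin m → ℝ) : ℝ := ∑ i, v i ^ 2

/-- fourth power of the ℓ₄ norm -/
def l4p4 {m : ℕ} (v : Fin m → ℝ) : ℝ := ∑ i, v i ^ 4

/-- Euclidean norm -/
def l2norm {m : ℕ} (v : Fin m → ℝ) : ℝ := Real.sqrt (l2sq v)

/-- squared sup-norm -/
def linfSq {m : ℕ} (v : Fin m → ℝ) : ℝ := ⨆ i, (v i) ^ 2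

/-- projection onto the orthogonal complement of q -/
def proj {p : ℕ} (q : Fin p → ℝ) : Matrix (Fin p) (Fin p) ℝ := 1 - Matrix.vecMulVec q q

def zeta {p r : ℕ} (A : Matrix (Fin p) (Fin r) ℝ) (q : Fin p → ℝ) : Fin r → ℝ := Aᵀ *ᵥ q

/-- population objective -/
def fpop {p r : ℕ} (θ : ℝ) (A : Matrix (Fin p) (Fin r) ℝ) (q : Fin p → ℝ) : ℝ :=
  -(1/4) * ((1 - θ) * l4p4 (zeta A q) + θ * (l2sq (zeta A q)) ^ 2)

/-- Riemannian gradient of the population objective -/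
def gradf {p r : ℕ} (θ : ℝ) (A : Matrix (Fin p) (Fin r) ℝ) (q : Fin p → ℝ) : Fin p → ℝ :=
  -((proj q) *ᵥ ((1 - θ) • (A *ᵥ fun j => (zeta A q j) ^ 3)
      + (θ * l2sq (zeta A q)) • (A *ᵥ zeta A q)))

/-- Riemannian Hessian of the population objective -/
def hessf {p r : ℕ} (θ : ℝ) (A : Matrix (Fin p) (Fin r) ℝ) (q : Fin p → ℝ) :
    Matrix (Fin p) (Fin p) ℝ :=
  -((1 - θ) • (proj q *
      ((3 : ℝ) • (A * Matrix.diagonal (fun j => (zeta A q j) ^ 2) * Aᵀ)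
        - l4p4 (zeta A q) • (1 : Matrix (Fin p) (Fin p) ℝ)) * proj q))
  - θ • (proj q *
      (l2sq (zeta A q) • (A * Aᵀ)
        + (2 : ℝ) • (A * Aᵀ * Matrix.vecMulVec q q * (A * Aᵀ))
        - (l2sq (zeta A q)) ^ 2 • (1 : Matrix (Fin p) (Fin p) ℝ)) * proj q)

/-- quadratic form -/
def qform {p : ℕ} (M : Matrix (Fin p) (Fin p) ℝ) (v : Fin p → ℝ) : ℝ := v ⬝ᵥ (M *ᵥ v)

/-- α(q) -/
def alphaf {p r : ℕ} (θ : ℝ) (A : Matrix (Fin p) (Fin r) ℝ) (q : Fin p → ℝ) : ℝ :=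
  l4p4 (zeta A q) + (θ / (1 - θ)) * ((l2sq (zeta A q)) ^ 2 - l2sq (zeta A q))

/-- columns of X -/
def colX {r n : ℕ} (X : Matrix (Fin r) (Fin n) ℝ) (k : Fin n) : Fin r → ℝ := fun i => X i k

/-- finite-sample objective -/
def Ffun {p r n : ℕ} (θ σ : ℝ) (A : Matrix (Fin p) (Fin r) ℝ) (X : Matrix (Fin r) (Fin n) ℝ)
    (q : Fin p → ℝ) : ℝ :=
  -(1 / (12 * θ * σ ^ 4 * n)) * ∑ k : Fin n, (q ⬝ᵥ (A *ᵥ colX X k)) ^ 4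

/-- Riemannian gradient of the finite-sample objective -/
def gradF {p r n : ℕ} (θ σ : ℝ) (A : Matrix (Fin p) (Fin r) ℝ) (X : Matrix (Fin r) (Fin n) ℝ)
    (q : Fin p → ℝ) : Fin p → ℝ :=
  (-(1 / (3 * θ * σ ^ 4 * n))) •
    ((proj q) *ᵥ ∑ k : Fin n, ((q ⬝ᵥ (A *ᵥ colX X k)) ^ 3) • (A *ᵥ colX X k))

/-- Riemannian Hessian of the finite-sample objective -/
def hessF {p r n : ℕ} (θ σ : ℝ) (A : Matrix (Fin p) (Fin r) ℝ) (X : Matrix (Fin r) (Fin n) ℝ)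
    (q : Fin p → ℝ) : Matrix (Fin p) (Fin p) ℝ :=
  (-(1 / (3 * θ * σ ^ 4 * n))) •
    ∑ k : Fin n, proj q *
      ((3 * (q ⬝ᵥ (A *ᵥ colX X k)) ^ 2) • Matrix.vecMulVec (A *ᵥ colX X k) (A *ᵥ colX X k)
        - ((q ⬝ᵥ (A *ᵥ colX X k)) ^ 4) • (1 : Matrix (Fin p) (Fin p) ℝ)) * proj q

/-- spectral norm of a rectangular matrix -/
def opNorm {m n : ℕ} (M : Matrix (Fin m) (Fin n) ℝ) : ℝ :=
  ‖LinearMap.toContinuousLinearMap (Matrix.toEuclideanLin M)‖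

/-- Bernoulli(θ) law on ℝ -/
def bernoulliReal (θ : ℝ) : Measure ℝ :=
  ENNReal.ofReal θ • Measure.dirac (1 : ℝ) + ENNReal.ofReal (1 - θ) • Measure.dirac (0 : ℝ)

/-- Bernoulli–Gaussian law BG(θ, σ²) on ℝ -/
def bgLaw (θ σ2 : ℝ) : Measure ℝ :=
  ((bernoulliReal θ).prod (gaussianReal 0 σ2.toNNReal)).map fun p => p.1 * p.2

/-- law of a random vector in ℝ^r with i.i.d. BG(θ, σ²) entries -/
def bgVec (r : ℕ) (θ σ2 : ℝ) : Measure (Fin r → ℝ) :=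
  Measure.pi fun _ : Fin r => bgLaw θ σ2

/-- law of a random r×n matrix with i.i.d. BG(θ, σ²) entries -/
def bgMatrix (r n : ℕ) (θ σ2 : ℝ) : Measure (Fin r → Fin n → ℝ) :=
  Measure.pi fun _ : Fin r => Measure.pi fun _ : Fin n => bgLaw θ σ2

lemma bgLaw_eq (θ s : ℝ) :
    bgLaw θ s = ENNReal.ofReal θ • gaussianReal 0 s.toNNReal
      + ENNReal.ofReal (1 - θ) • Measure.dirac (0 : ℝ) := by
  unfold bgLaw bernoulliReal
  have hm : Measurable fun p : ℝ × ℝ => p.1 * p.2 := by fun_prop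
  rw [Measure.add_prod, Measure.prod_smul_left, Measure.prod_smul_left, Measure.map_add _ _ hm,
    Measure.map_smul, Measure.map_smul, Measure.dirac_prod, Measure.dirac_prod,
    Measure.map_map hm (by fun_prop), Measure.map_map hm (by fun_prop)]
  have h1 : (fun p : ℝ × ℝ => p.1 * p.2) ∘ Prod.mk (1 : ℝ) = id := by ext; simp
  have h0 : (fun p : ℝ × ℝ => p.1 * p.2) ∘ Prod.mk (0 : ℝ) = fun _ => 0 := by ext; simp
  rw [h1, h0, Measure.map_id, Measure.map_const]
  simp

lemma isProbabilityMeasure_bgLaw {θ : ℝ} (s : ℝ) (h0 : 0 ≤ θ) (h1 : θ ≤ 1) :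
    IsProbabilityMeasure (bgLaw θ s) := by
  constructor
  rw [bgLaw_eq]
  simp only [Measure.coe_add, Measure.coe_smul, Pi.add_apply, Pi.smul_apply, measure_univ,
    smul_eq_mul, mul_one]
  rw [← ENNReal.ofReal_add h0 (by linarith)]
  simp

lemma bgLaw_sq (θ : ℝ) (σ : ℝ) : bgLaw θ (σ ^ 2) = (bgLaw θ 1).map (σ • ·) := by
  have hm : Measurable fun x : ℝ => σ • x := by fun_prop
  rw [bgLaw_eq, bgLaw_eq, Measure.map_add _ _ hm, Measure.map_smul, Measure.map_smul,
    Measure.map_dirac' hm]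
  have := gaussianReal_map_const_mul (μ := 0) (v := Real.toNNReal 1) σ
  simp only [smul_eq_mul, mul_zero] at this ⊢
  rw [this]
  congr 3
  ext
  simp [sq_nonneg]

lemma integrable_bgLaw {θ : ℝ} {f : ℝ → ℝ} (hf : Integrable f (gaussianReal 0 1)) :
    Integrable f (bgLaw θ 1) := by
  rw [bgLaw_eq, Real.toNNReal_one]
  exact (hf.smul_measure ENNReal.ofReal_ne_top).add_measure
    ((integrable_dirac (by simp)).smul_measure ENNReal.ofReal_ne_top)

lemma integral_bgLaw {θ : ℝ} (h0 : 0 ≤ θ) (h1 : θ ≤ 1) {f : ℝ → ℝ}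
    (hf : Integrable f (gaussianReal 0 1)) :
    ∫ x, f x ∂(bgLaw θ 1) = θ * ∫ x, f x ∂(gaussianReal 0 1) + (1 - θ) * f 0 := by
  rw [bgLaw_eq, Real.toNNReal_one, integral_add_measure (hf.smul_measure ENNReal.ofReal_ne_top)
    ((integrable_dirac (by simp)).smul_measure ENNReal.ofReal_ne_top),
    integral_smul_measure, integral_smul_measure, integral_dirac,
    ENNReal.toReal_ofReal h0, ENNReal.toReal_ofReal (by linarith)]
  simp

lemma integral_exp_mul_bgLaw {θ : ℝ} (h0 : 0 ≤ θ) (h1 : θ ≤ 1) (t : ℝ) :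
    ∫ x, exp (t * x) ∂(bgLaw θ 1) = 1 + θ * (exp (t ^ 2 / 2) - 1) := by
  rw [integral_bgLaw h0 h1 (integrable_exp_mul_gaussianReal t)]
  have := congrFun (mgf_id_gaussianReal (μ := 0) (v := 1)) t
  simp only [mgf, id] at this
  rw [this]
  simp
  ring

lemma integrable_exp_sq_gaussianReal :
    Integrable (fun x => exp (x ^ 2 / 4)) (gaussianReal 0 1) ∧
      ∫ x, exp (x ^ 2 / 4) ∂(gaussianReal 0 1) = √2 := by
  have hpdf : ∀ x : ℝ, gaussianPDFReal 0 1 x * exp (x ^ 2 / 4)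
      = (√(2 * π))⁻¹ * exp (-(1 / 4) * x ^ 2) := by
    intro x
    simp only [gaussianPDFReal, NNReal.coe_one, mul_one, sub_zero]
    rw [mul_assoc, ← exp_add]
    congr 2
    ring
  constructor
  · rw [gaussianReal_of_var_ne_zero _ one_ne_zero,
      integrable_withDensity_iff_integrable_smul' (by fun_prop) (by simp [gaussianPDF])]
    have : (fun x => (gaussianPDF 0 1 x).toReal • exp (x ^ 2 / 4))
        = fun x => (√(2 * π))⁻¹ * exp (-(1 / 4) * x ^ 2) := by
      ext x
      rw [toReal_gaussianPDF, smul_eq_mul, hpdf]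
    rw [this]
    exact (integrable_exp_neg_mul_sq (by norm_num)).const_mul _
  · rw [integral_gaussianReal_eq_integral_smul one_ne_zero]
    simp only [smul_eq_mul, hpdf]
    rw [integral_const_mul, integral_gaussian, ← sqrt_inv, ← sqrt_mul (by positivity)]
    congr 1
    field_simp
    norm_num

lemma gaussianReal_moments :
    (∀ k : ℕ, Integrable (fun x : ℝ => x ^ k) (gaussianReal 0 1)) ∧
    ∫ x, x ∂(gaussianReal 0 1) = 0 ∧ ∫ x, x ^ 2 ∂(gaussianReal 0 1) = 1 ∧
    ∫ x, x ^ 3 ∂(gaussianReal 0 1) = 0 ∧ ∫ x, x ^ 4 ∂(gaussianReal 0 1) = 3 := by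
  have huniv : integrableExpSet id (gaussianReal 0 1) = Set.univ :=
    integrableExpSet_id_gaussianReal
  have hIntegrable : (0 : ℝ) ∈ interior (integrableExpSet id (gaussianReal 0 1)) := by simp [huniv]
  have hmom : ∀ k : ℕ, iteratedDeriv k (fun t : ℝ => exp (t ^ 2 / 2)) 0
      = ∫ x, x ^ k ∂(gaussianReal 0 1) := by
    intro k
    have := iteratedDeriv_mgf_zero hIntegrable k
    rw [mgf_id_gaussianReal] at this
    simpa using this
  have d1 : deriv (fun t : ℝ => exp (t ^ 2 / 2)) = fun t => t * exp (t ^ 2 / 2) := by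
    ext t
    have h : HasDerivAt (fun t : ℝ => t ^ 2 / 2) t t := by
      simpa using ((hasDerivAt_pow 2 t).div_const 2)
    rw [h.exp.deriv]; ring
  have d2 : ∀ (P P' : ℝ → ℝ), (∀ t, HasDerivAt P (P' t) t) →
      deriv (fun t : ℝ => P t * exp (t ^ 2 / 2))
        = fun t => (P' t + t * P t) * exp (t ^ 2 / 2) := by
    intro P P' hP
    ext t
    have h : HasDerivAt (fun t : ℝ => t ^ 2 / 2) t t := by
      simpa using ((hasDerivAt_pow 2 t).div_const 2)
    rw [((hP t).fun_mul h.exp).deriv]; ring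
  have e1 : iteratedDeriv 1 (fun t : ℝ => exp (t ^ 2 / 2)) = fun t => t * exp (t ^ 2 / 2) := by
    rw [iteratedDeriv_one, d1]
  have e2 : iteratedDeriv 2 (fun t : ℝ => exp (t ^ 2 / 2))
      = fun t => (1 + t * t) * exp (t ^ 2 / 2) := by
    rw [iteratedDeriv_succ, e1, d2 (fun t => t) (fun _ => 1) hasDerivAt_id']
  have e3 : iteratedDeriv 3 (fun t : ℝ => exp (t ^ 2 / 2))
      = fun t => (2 * t + t * (1 + t * t)) * exp (t ^ 2 / 2) := by
    rw [iteratedDeriv_succ, e2, d2 (fun t => 1 + t * t) (fun t => 2 * t)]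
    intro t
    refine (((hasDerivAt_id' t).fun_mul (hasDerivAt_id' t)).const_add 1).congr_deriv ?_
    ring
  have e4 : iteratedDeriv 4 (fun t : ℝ => exp (t ^ 2 / 2))
      = fun t => (3 + 3 * t ^ 2 + t * (2 * t + t * (1 + t * t))) * exp (t ^ 2 / 2) := by
    rw [iteratedDeriv_succ, e3,
      d2 (fun t => 2 * t + t * (1 + t * t)) (fun t => 3 + 3 * t ^ 2)]
    intro t
    have h := ((hasDerivAt_id' t).fun_mul (hasDerivAt_id' t)).const_add 1
    refine (((hasDerivAt_id' t).const_mul 2).fun_add ((hasDerivAt_id' t).fun_mul h)).congr_deriv ?_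
    ring
  refine ⟨fun k => ?_, ?_, ?_, ?_, ?_⟩
  · exact integrable_pow_of_mem_interior_integrableExpSet hIntegrable k
  · exact integral_id_gaussianReal
  · simpa [e2] using (hmom 2).symm
  · simpa [e3] using (hmom 3).symm
  · simpa [e4] using (hmom 4).symm

lemma bgLaw_moments {θ : ℝ} (h0 : 0 ≤ θ) (h1 : θ ≤ 1) :
    ∫ x, x ∂(bgLaw θ 1) = 0 ∧ ∫ x, x ^ 2 ∂(bgLaw θ 1) = θ ∧
    ∫ x, x ^ 3 ∂(bgLaw θ 1) = 0 ∧ ∫ x, x ^ 4 ∂(bgLaw θ 1) = 3 * θ := by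
  obtain ⟨hi, m1, m2, m3, m4⟩ := gaussianReal_moments
  have hi1 : Integrable (fun x : ℝ => x) (gaussianReal 0 1) := by simpa using hi 1
  rw [integral_bgLaw h0 h1 hi1, integral_bgLaw h0 h1 (hi 2), integral_bgLaw h0 h1 (hi 3),
    integral_bgLaw h0 h1 (hi 4), m1, m2, m3, m4]
  norm_num
  ring

lemma integral_exp_sq_bgLaw_le {θ : ℝ} (h0 : 0 ≤ θ) (h1 : θ ≤ 1) :
    ∫ x, exp (x ^ 2 / 4) ∂(bgLaw θ 1) ≤ exp (θ / 2) := by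
  rw [integral_bgLaw h0 h1 integrable_exp_sq_gaussianReal.1, integrable_exp_sq_gaussianReal.2]
  have h2 : √2 ≤ 3 / 2 := by
    rw [sqrt_le_left (by norm_num)]; norm_num
  have := add_one_le_exp (θ / 2)
  simp only [ne_eq, OfNat.ofNat_ne_zero, not_false_eq_true, zero_pow, zero_div, exp_zero, mul_one]
  nlinarith

lemma integrable_exp_dotProduct_bgVec {r : ℕ} {θ : ℝ} (h0 : 0 ≤ θ) (h1 : θ ≤ 1)
    (b : Fin r → ℝ) : Integrable (fun x => exp (b ⬝ᵥ x)) (bgVec r θ 1) := by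
  have := isProbabilityMeasure_bgLaw 1 h0 h1
  simp only [dotProduct, exp_sum, bgVec]
  exact Integrable.fintype_prod (f := fun i x => exp (b i * x))
    fun i => integrable_bgLaw (integrable_exp_mul_gaussianReal (b i))

lemma integral_exp_dotProduct_bgVec_le {r : ℕ} {θ : ℝ} (h0 : 0 ≤ θ) (h1 : θ ≤ 1)
    {b : Fin r → ℝ} (hb : l2sq b ≤ 2) :
    ∫ x, exp (b ⬝ᵥ x) ∂(bgVec r θ 1) ≤ exp (2 * θ) := by
  have := isProbabilityMeasure_bgLaw 1 h0 h1
  simp only [dotProduct, exp_sum, bgVec]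
  rw [integral_fintype_prod_eq_prod (fun i x => exp (b i * x))]
  calc ∏ i, ∫ x, exp (b i * x) ∂(bgLaw θ 1) ≤ ∏ i, exp (θ * b i ^ 2) := by
        refine Finset.prod_le_prod (fun i _ => integral_nonneg fun x => (exp_pos _).le)
          fun i _ => ?_
        rw [integral_exp_mul_bgLaw h0 h1]
        have hi : b i ^ 2 ≤ 2 :=
          (Finset.single_le_sum (f := fun j => b j ^ 2) (fun j _ => sq_nonneg _)
            (Finset.mem_univ i)).trans hb
        have hpos : 0 ≤ b i ^ 2 / 2 := by positivity
        have h := (le_abs_self _).trans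
          (Real.abs_exp_sub_one_le (x := b i ^ 2 / 2) (by rw [abs_of_nonneg hpos]; linarith))
        rw [abs_of_nonneg hpos] at h
        have := add_one_le_exp (θ * b i ^ 2)
        nlinarith
    _ = exp (θ * l2sq b) := by rw [← exp_sum, ← Finset.mul_sum]; rfl
    _ ≤ exp (2 * θ) := exp_le_exp.mpr (by nlinarith)

lemma pow_eight_le_cosh (y : ℝ) : y ^ 8 ≤ 40320 * (cosh y - 1) := by
  have h := Real.hasSum_cosh y
  have := sum_le_hasSum (Finset.range 5) (fun i _ => by
    rw [pow_mul]; positivity) h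
  simp only [Finset.sum_range_succ, Finset.sum_range_zero] at this
  norm_num [Nat.factorial] at this
  nlinarith [sq_nonneg y, sq_nonneg (y ^ 2), sq_nonneg (y ^ 3)]

lemma pow_eight_bgVec {r : ℕ} {θ : ℝ} (h0 : 0 ≤ θ) (h1 : θ ≤ 1 / 9)
    {b : Fin r → ℝ} (hb : l2sq b ≤ 2) :
    Integrable (fun x => (b ⬝ᵥ x) ^ 8) (bgVec r θ 1) ∧
      ∫ x, (b ⬝ᵥ x) ^ 8 ∂(bgVec r θ 1) ≤ 120960 * θ := by
  have hθ : θ ≤ 1 := by linarith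
  have := isProbabilityMeasure_bgLaw 1 h0 hθ
  have : IsProbabilityMeasure (bgVec r θ 1) := by unfold bgVec; infer_instance
  have hp := integrable_exp_dotProduct_bgVec h0 hθ b
  have hn := integrable_exp_dotProduct_bgVec h0 hθ (-b)
  have hcosh : Integrable (fun x => 40320 * (cosh (b ⬝ᵥ x) - 1)) (bgVec r θ 1) := by
    simp only [cosh_eq, ← neg_dotProduct]
    exact (((hp.add hn).div_const 2).sub (integrable_const 1)).const_mul _
  have hIntegrable : Integrable (fun x => (b ⬝ᵥ x) ^ 8) (bgVec r θ 1) := by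
    refine hcosh.mono' (Measurable.aestronglyMeasurable ?_) (.of_forall fun x => ?_)
    · simp only [dotProduct]; fun_prop
    · rw [norm_eq_abs, abs_of_nonneg (by positivity)]
      exact pow_eight_le_cosh _
  refine ⟨hIntegrable, (integral_mono hIntegrable hcosh fun x => pow_eight_le_cosh _).trans ?_⟩
  simp only [cosh_eq, ← neg_dotProduct]
  rw [integral_const_mul, integral_sub (by exact (hp.add hn).div_const 2) (integrable_const 1),
    integral_div, integral_add hp hn]
  have e1 := integral_exp_dotProduct_bgVec_le h0 hθ hb
  have e2 := integral_exp_dotProduct_bgVec_le h0 hθ (b := -b) (by simpa [l2sq] using hb)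
  have e3 : exp (2 * θ) ≤ 1 + 3 * θ := by
    have := Real.abs_exp_sub_one_sub_id_le (x := 2 * θ) (by rw [abs_of_nonneg] <;> linarith)
    have := (le_abs_self _).trans this
    nlinarith
  simp only [integral_const, probReal_univ, smul_eq_mul, mul_one]
  linarith

lemma measure_l2sq_gt_bgVec_le {r : ℕ} {θ : ℝ} (h0 : 0 ≤ θ) (h1 : θ ≤ 1) (R : ℝ) :
    (bgVec r θ 1).real {x | R ≤ l2sq x} ≤ exp (θ * r / 2 - R / 4) := by
  have := isProbabilityMeasure_bgLaw 1 h0 h1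
  have : IsProbabilityMeasure (bgVec r θ 1) := by unfold bgVec; infer_instance
  have hexp : ∀ x : Fin r → ℝ, exp (1 / 4 * l2sq x) = ∏ i, exp (x i ^ 2 / 4) := by
    intro x
    rw [← exp_sum, ← Finset.sum_div]
    congr 1
    simp only [l2sq]; ring
  have hIntegrable : Integrable (fun x => exp (1 / 4 * l2sq x)) (bgVec r θ 1) := by
    simp only [hexp, bgVec]
    exact Integrable.fintype_prod (f := fun _ x => exp (x ^ 2 / 4))
      fun i => integrable_bgLaw integrable_exp_sq_gaussianReal.1
  refine (measure_ge_le_exp_mul_mgf R (by norm_num : (0 : ℝ) ≤ 1 / 4) hIntegrable).trans ?_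
  have hm : mgf l2sq (bgVec r θ 1) (1 / 4) ≤ exp (θ * r / 2) := by
    simp only [mgf, hexp, bgVec]
    rw [integral_fintype_prod_eq_pow (fun x => exp (x ^ 2 / 4))]
    refine (pow_le_pow_left₀ (integral_nonneg fun x => (exp_pos _).le)
      (integral_exp_sq_bgLaw_le h0 h1) _).trans (le_of_eq ?_)
    rw [← exp_nat_mul, Fintype.card_fin]
    congr 1; ring
  rw [sub_eq_add_neg, exp_add, mul_comm]
  exact mul_le_mul hm (le_of_eq (by congr 1; ring)) (exp_pos _).le (exp_pos _).le

lemma sum_mul_moments_bgVec {r : ℕ} {θ : ℝ} (h0 : 0 ≤ θ) (h1 : θ ≤ 1)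
    (b : Fin r → ℝ) (s : Finset (Fin r)) :
    (∀ k : ℕ, Integrable (fun x => (∑ i ∈ s, b i * x i) ^ k) (bgVec r θ 1)) ∧
    ∫ x, (∑ i ∈ s, b i * x i) ^ 2 ∂(bgVec r θ 1) = θ * ∑ i ∈ s, b i ^ 2 ∧
    ∫ x, (∑ i ∈ s, b i * x i) ^ 4 ∂(bgVec r θ 1)
      = 3 * θ * ((1 - θ) * ∑ i ∈ s, b i ^ 4 + θ * (∑ i ∈ s, b i ^ 2) ^ 2) := by
  have := isProbabilityMeasure_bgLaw 1 h0 h1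
  have : IsProbabilityMeasure (bgVec r θ 1) := by unfold bgVec; infer_instance
  obtain ⟨m1, m2, m3, m4⟩ := bgLaw_moments h0 h1
  have hmp : ∀ i, MeasurePreserving (Function.eval i) (bgVec r θ 1) (bgLaw θ 1) := fun i =>
    measurePreserving_eval (fun _ : Fin r => bgLaw θ 1) i
  have hyint : ∀ i (k : ℕ), Integrable (fun x => (b i * x i) ^ k) (bgVec r θ 1) := by
    intro i k
    simp only [mul_pow]
    exact ((hmp i).integrable_comp_of_integrable
      (integrable_bgLaw (gaussianReal_moments.1 k))).const_mul _
  have hyval : ∀ i (k : ℕ), ∫ x, (b i * x i) ^ k ∂(bgVec r θ 1)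
      = b i ^ k * ∫ x, x ^ k ∂(bgLaw θ 1) := by
    intro i k
    simp only [mul_pow]
    rw [integral_const_mul, ← (hmp i).map_eq,
      integral_map (by exact (measurable_pi_apply i).aemeasurable) (by fun_prop)]
  have hind : iIndepFun (fun i x => b i * x i) (bgVec r θ 1) :=
    iIndepFun_pi (X := fun i y => b i * y) fun i => by fun_prop
  induction s using Finset.induction_on with
  | empty =>
    refine ⟨fun k => by simp, by simp, by simp⟩
  | insert i s hi ih =>
    obtain ⟨hI, h2, h4⟩ := ih
    have hindep : IndepFun (fun x : Fin r → ℝ => ∑ j ∈ s, b j * x j) (fun x => b i * x i)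
        (bgVec r θ 1) := by
      have := hind.indepFun_finsetSum_of_notMem (fun j => by fun_prop) hi
      convert this using 1
      ext x; simp
    have hpow : ∀ k l : ℕ, Integrable
        (fun x => (∑ j ∈ s, b j * x j) ^ k * (b i * x i) ^ l) (bgVec r θ 1) ∧
        ∫ x, (∑ j ∈ s, b j * x j) ^ k * (b i * x i) ^ l ∂(bgVec r θ 1)
          = (∫ x, (∑ j ∈ s, b j * x j) ^ k ∂(bgVec r θ 1))
            * (b i ^ l * ∫ x, x ^ l ∂(bgLaw θ 1)) := by
      intro k l
      have h := hindep.comp (φ := fun y => y ^ k) (ψ := fun y => y ^ l)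
        (by fun_prop) (by fun_prop)
      refine ⟨h.integrable_mul (hI k) (hyint i l), ?_⟩
      rw [← hyval i l]
      exact h.integral_fun_mul_eq_mul_integral (hI k).aestronglyMeasurable
        (hyint i l).aestronglyMeasurable
    have hadd : ∀ (k : ℕ) (x : Fin r → ℝ), (∑ j ∈ insert i s, b j * x j) ^ k
        = ∑ m ∈ Finset.range (k + 1),
          (k.choose m : ℝ) * ((∑ j ∈ s, b j * x j) ^ m * (b i * x i) ^ (k - m)) := by
      intro k x
      rw [Finset.sum_insert hi, add_comm, add_pow]
      exact Finset.sum_congr rfl fun m _ => by ring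
    have hval : ∀ k : ℕ, ∫ x, (∑ j ∈ insert i s, b j * x j) ^ k ∂(bgVec r θ 1)
        = ∑ m ∈ Finset.range (k + 1), (k.choose m : ℝ)
          * ((∫ x, (∑ j ∈ s, b j * x j) ^ m ∂(bgVec r θ 1))
            * (b i ^ (k - m) * ∫ x, x ^ (k - m) ∂(bgLaw θ 1))) := by
      intro k
      simp only [hadd]
      rw [integral_finsetSum _ fun m _ => ((hpow m (k - m)).1.const_mul _)]
      exact Finset.sum_congr rfl fun m _ => by rw [integral_const_mul, (hpow m (k - m)).2]
    refine ⟨fun k => ?_, ?_, ?_⟩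
    · simp only [hadd]
      exact integrable_finsetSum _ fun m _ => (hpow m (k - m)).1.const_mul _
    · rw [hval, Finset.sum_insert hi]
      simp [Finset.sum_range_succ, m1, m2, h2]
      ring
    · rw [hval, Finset.sum_insert hi, Finset.sum_insert hi]
      simp [Finset.sum_range_succ, m1, m2, m3, m4, h2, h4, Nat.choose]
      ring

lemma pow_four_bgVec {r : ℕ} {θ : ℝ} (h0 : 0 ≤ θ) (h1 : θ ≤ 1) (b : Fin r → ℝ) :
    Integrable (fun x => (b ⬝ᵥ x) ^ 4) (bgVec r θ 1) ∧
    ∫ x, (b ⬝ᵥ x) ^ 4 ∂(bgVec r θ 1)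
      = 3 * θ * ((1 - θ) * l4p4 b + θ * (l2sq b) ^ 2) :=
  ⟨(sum_mul_moments_bgVec h0 h1 b Finset.univ).1 4,
    (sum_mul_moments_bgVec h0 h1 b Finset.univ).2.2⟩

section Bernstein

variable {E : Type*} [MeasurableSpace E] {ν : Measure E} [IsProbabilityMeasure ν] {g : E → ℝ}
  {M v : ℝ}

lemma integral_exp_mul_le_of_centered (hg : Measurable g) (hM : ∀ x, |g x| ≤ M)
    (h0 : ∫ x, g x ∂ν = 0) (hv : ∫ x, g x ^ 2 ∂ν ≤ v) {l : ℝ} (hl : 0 ≤ l) (hlM : l * M ≤ 1) :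
    Integrable (fun x => exp (l * g x)) ν ∧ ∫ x, exp (l * g x) ∂ν ≤ exp (l ^ 2 * v) := by
  have hgi : Integrable g ν :=
    .of_bound hg.aestronglyMeasurable M (.of_forall hM)
  have hg2 : Integrable (fun x => g x ^ 2) ν := by
    refine .of_bound (hg.pow_const 2).aestronglyMeasurable (M ^ 2) (.of_forall fun x => ?_)
    rw [norm_pow]
    exact pow_le_pow_left₀ (norm_nonneg _) (hM x) 2
  have hle : ∀ x, |l * g x| ≤ 1 := fun x => by
    rw [abs_mul, abs_of_nonneg hl]
    exact (mul_le_mul_of_nonneg_left (hM x) hl).trans hlM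
  have hpt : ∀ x, exp (l * g x) ≤ 1 + l * g x + l ^ 2 * g x ^ 2 := fun x => by
    have := (le_abs_self _).trans (Real.abs_exp_sub_one_sub_id_le (hle x))
    nlinarith
  have hei : Integrable (fun x => exp (l * g x)) ν := by
    refine .of_bound (by fun_prop) (exp 1) (.of_forall fun x => ?_)
    rw [norm_eq_abs, abs_exp]
    exact exp_le_exp.mpr ((le_abs_self _).trans (hle x))
  have hq : Integrable (fun x => 1 + l * g x + l ^ 2 * g x ^ 2) ν :=
    ((integrable_const 1).add (hgi.const_mul l)).add (hg2.const_mul _)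
  refine ⟨hei, (integral_mono hei hq hpt).trans ?_⟩
  rw [integral_add (by exact (integrable_const 1).add (hgi.const_mul l)) (hg2.const_mul _),
    integral_add (integrable_const 1) (hgi.const_mul l), integral_const_mul, integral_const_mul, h0]
  simp only [integral_const, probReal_univ, smul_eq_mul, mul_one, mul_zero, add_zero]
  have := add_one_le_exp (l ^ 2 * v)
  nlinarith [sq_nonneg l]

lemma measure_sum_ge_le_of_centered (n : ℕ) (hg : Measurable g) (hM : ∀ x, |g x| ≤ M)
    (h0 : ∫ x, g x ∂ν = 0) (hv : ∫ x, g x ^ 2 ∂ν ≤ v) {l : ℝ} (hl : 0 ≤ l) (hlM : l * M ≤ 1)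
    (s : ℝ) :
    (Measure.pi fun _ : Fin n => ν).real {Y | s ≤ ∑ k, g (Y k)}
      ≤ exp (-l * s + n * (l ^ 2 * v)) := by
  obtain ⟨hei, hle⟩ := integral_exp_mul_le_of_centered hg hM h0 hv hl hlM
  have hexp : ∀ Y : Fin n → E, exp (l * ∑ k, g (Y k)) = ∏ k, exp (l * g (Y k)) := fun Y => by
    rw [← exp_sum, Finset.mul_sum]
  refine (measure_ge_le_exp_mul_mgf (X := fun Y : Fin n → E => ∑ k, g (Y k)) s hl ?_).trans ?_
  · simp only [hexp]
    exact Integrable.fintype_prod (f := fun _ x => exp (l * g x)) fun _ => hei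
  · rw [exp_add]
    refine mul_le_mul_of_nonneg_left ?_ (exp_pos _).le
    simp only [mgf, hexp]
    rw [integral_fintype_prod_eq_pow (fun x => exp (l * g x)), Fintype.card_fin, exp_nat_mul]
    exact pow_le_pow_left₀ (integral_nonneg fun x => (exp_pos _).le) hle _

/-- Bernstein inequality for sums of i.i.d. bounded centered variables. -/
lemma bernstein_inequality {n : ℕ} (hn : 0 < n) (hg : Measurable g) (hM : ∀ x, |g x| ≤ M)
    (hM0 : 0 < M) (h0 : ∫ x, g x ∂ν = 0) (hv : ∫ x, g x ^ 2 ∂ν ≤ v) (hv0 : 0 < v)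
    {L : ℝ} (hL : 0 < L) :
    (Measure.pi fun _ : Fin n => ν).real
        {Y | n * (2 * √(v * L / n) + 2 * (M * L / n)) ≤ ∑ k, g (Y k)} ≤ exp (-L) := by
  have hn' : (0 : ℝ) < n := Nat.cast_pos.mpr hn
  set w := √(v * L / n) with hw
  have hw0 : 0 < w := sqrt_pos.mpr (by positivity)
  have hw2 : w ^ 2 * n = v * L := by
    rw [hw, sq_sqrt (by positivity)]; field_simp
  have hML : n * (2 * w + 2 * (M * L / n)) = 2 * (n * w) + 2 * (M * L) := by field_simp
  rw [hML]
  rcases le_total (w / v) (1 / M) with h | h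
  · have hlM : w / v * M ≤ 1 := by
      rw [le_div_iff₀ hM0] at h; exact h
    refine (measure_sum_ge_le_of_centered n hg hM h0 hv (by positivity) hlM _).trans
      (exp_le_exp.mpr ?_)
    have e1 : n * ((w / v) ^ 2 * v) = L := by
      field_simp; nlinarith
    have e2 : w / v * (2 * (n * w)) = 2 * L := by
      field_simp; nlinarith
    have e3 : 0 ≤ w / v * (2 * (M * L)) := by positivity
    rw [e1]
    nlinarith
  · have hlM : 1 / M * M ≤ 1 := by field_simp; exact le_rfl
    refine (measure_sum_ge_le_of_centered n hg hM h0 hv (by positivity) hlM _).trans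
      (exp_le_exp.mpr ?_)
    have e1 : n * ((1 / M) ^ 2 * v) ≤ L := by
      have : (1 / M) ^ 2 ≤ (w / v) ^ 2 := pow_le_pow_left₀ (by positivity) h 2
      calc n * ((1 / M) ^ 2 * v) ≤ n * ((w / v) ^ 2 * v) := by gcongr
        _ = L := by field_simp; nlinarith
    have e2 : 1 / M * (2 * (M * L)) = 2 * L := by field_simp
    have e3 : 0 ≤ 1 / M * (2 * (n * w)) := by positivity
    nlinarith

end Bernstein

/-- Deviation of the normalized empirical fourth moment from its expectation. -/
def quarticDev {r n : ℕ} (θ : ℝ) (Y : Fin n → Fin r → ℝ) (a : Fin r → ℝ) : ℝ :=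
  (∑ k, (a ⬝ᵥ Y k) ^ 4) / (3 * θ * n) - ((1 - θ) * l4p4 a + θ * (l2sq a) ^ 2)

/-- Four-point-plus-centre Lagrange interpolation, exact on quartic polynomials. -/
lemma quarticDev_interpolation {r n : ℕ} (θ : ℝ) (Y : Fin n → Fin r → ℝ) (b w : Fin r → ℝ) :
    quarticDev θ Y (b + (1 / 100 : ℝ) • w) =
      (9999 * 39999 / 400000000) * quarticDev θ Y b
      + (101 * 39999 / 600000000) * quarticDev θ Y (b + (1 : ℝ) • w)
      - (99 * 39999 / 600000000) * quarticDev θ Y (b + (-1 : ℝ) • w)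
      - (9999 * 201 / 2400000000) * quarticDev θ Y (b + (2 : ℝ) • w)
      + (9999 * 199 / 2400000000) * quarticDev θ Y (b + (-2 : ℝ) • w) := by
  have hdot : ∀ (t : ℝ), ∑ k, ((b + t • w) ⬝ᵥ Y k) ^ 4
      = ∑ k, (b ⬝ᵥ Y k) ^ 4 + t * ∑ k, 4 * (b ⬝ᵥ Y k) ^ 3 * (w ⬝ᵥ Y k)
        + t ^ 2 * ∑ k, 6 * (b ⬝ᵥ Y k) ^ 2 * (w ⬝ᵥ Y k) ^ 2
        + t ^ 3 * ∑ k, 4 * (b ⬝ᵥ Y k) * (w ⬝ᵥ Y k) ^ 3 + t ^ 4 * ∑ k, (w ⬝ᵥ Y k) ^ 4 := by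
    intro t
    simp only [Finset.mul_sum, ← Finset.sum_add_distrib]
    refine Finset.sum_congr rfl fun k _ => ?_
    rw [add_dotProduct, smul_dotProduct, smul_eq_mul]
    ring
  have h4 : ∀ (t : ℝ), l4p4 (b + t • w)
      = l4p4 b + t * ∑ i, 4 * b i ^ 3 * w i + t ^ 2 * ∑ i, 6 * b i ^ 2 * w i ^ 2
        + t ^ 3 * ∑ i, 4 * b i * w i ^ 3 + t ^ 4 * l4p4 w := by
    intro t
    simp only [l4p4, Finset.mul_sum, ← Finset.sum_add_distrib]
    refine Finset.sum_congr rfl fun k _ => ?_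
    simp only [Pi.add_apply, Pi.smul_apply, smul_eq_mul]
    ring
  have h2 : ∀ (t : ℝ), l2sq (b + t • w)
      = l2sq b + t * ∑ i, 2 * b i * w i + t ^ 2 * l2sq w := by
    intro t
    simp only [l2sq, Finset.mul_sum, ← Finset.sum_add_distrib]
    refine Finset.sum_congr rfl fun k _ => ?_
    simp only [Pi.add_apply, Pi.smul_apply, smul_eq_mul]
    ring
  simp only [quarticDev, hdot, h4, h2]
  ring

lemma quarticDev_smul {r n : ℕ} (θ : ℝ) (Y : Fin n → Fin r → ℝ) (c : ℝ) (a : Fin r → ℝ) :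
    quarticDev θ Y (c • a) = c ^ 4 * quarticDev θ Y a := by
  simp only [quarticDev, l4p4, l2sq, smul_dotProduct, Pi.smul_apply, smul_eq_mul, mul_pow,
    ← Finset.mul_sum]
  ring

lemma l2sq_nonneg {m : ℕ} (a : Fin m → ℝ) : 0 ≤ l2sq a :=
  Finset.sum_nonneg fun _ _ => sq_nonneg _

lemma l2sq_smul {m : ℕ} (c : ℝ) (a : Fin m → ℝ) : l2sq (c • a) = c ^ 2 * l2sq a := by
  simp only [l2sq, Pi.smul_apply, smul_eq_mul, mul_pow, Finset.mul_sum]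

lemma l2sq_eq_zero {m : ℕ} {a : Fin m → ℝ} (h : l2sq a = 0) : a = 0 := by
  ext i
  have := (Finset.sum_eq_zero_iff_of_nonneg fun i _ => sq_nonneg (a i)).mp h i (Finset.mem_univ i)
  simpa using this

lemma sqrt_l2sq_add_le {m : ℕ} (a b : Fin m → ℝ) :
    √(l2sq (a + b)) ≤ √(l2sq a) + √(l2sq b) := by
  have h := norm_add_le (WithLp.toLp 2 a) (WithLp.toLp 2 b)
  rw [← WithLp.toLp_add] at h
  simpa [EuclideanSpace.norm_eq, l2sq] using h

lemma l2sq_add_smul_sq_le {m : ℕ} {b w : Fin m → ℝ} (hb : l2sq b ≤ (6 / 5) ^ 2) (hw : l2sq w ≤ 1)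
    (t : ℝ) : (l2sq (b + t • w)) ^ 2 ≤ (6 / 5 + |t|) ^ 4 := by
  have h := sqrt_l2sq_add_le b (t • w)
  rw [l2sq_smul, sqrt_mul (sq_nonneg t), sqrt_sq_eq_abs] at h
  have h1 : √(l2sq b) ≤ 6 / 5 := by rw [sqrt_le_left (by norm_num)]; exact hb
  have h2 : √(l2sq w) ≤ 1 := by rw [sqrt_le_left (by norm_num)]; simpa using hw
  have h3 : √(l2sq (b + t • w)) ≤ 6 / 5 + |t| := by nlinarith [abs_nonneg t]
  have h4 : (l2sq (b + t • w)) ^ 2 = √(l2sq (b + t • w)) ^ 4 := by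
    rw [show (4 : ℕ) = 2 * 2 from rfl, pow_mul, sq_sqrt (l2sq_nonneg _)]
  rw [h4]
  exact pow_le_pow_left₀ (sqrt_nonneg _) h3 4

/-- A quartic deviation that is small near every unit vector is small everywhere. -/
lemma abs_quarticDev_le_of_net {r n : ℕ} (hr : 1 ≤ r) (θ : ℝ) (Y : Fin n → Fin r → ℝ) {δ : ℝ}
    (hnet : ∀ a, l2sq a = 1 → ∃ b, l2sq b ≤ (6 / 5) ^ 2 ∧ l2sq (a - b) ≤ 1 / 100 ^ 2 ∧
      |quarticDev θ Y b| ≤ δ) (a : Fin r → ℝ) :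
    |quarticDev θ Y a| ≤ 3 * δ * (l2sq a) ^ 2 := by
  have hcont : Continuous fun a : Fin r → ℝ => |quarticDev θ Y a| := by
    unfold quarticDev l4p4 l2sq dotProduct
    fun_prop
  have hclosed : IsClosed {a : Fin r → ℝ | l2sq a = 1} := by
    refine isClosed_eq ?_ continuous_const
    unfold l2sq; fun_prop
  have hcompact : IsCompact {a : Fin r → ℝ | l2sq a = 1} := by
    refine Metric.isCompact_of_isClosed_isBounded hclosed
      ((Metric.isBounded_closedBall (x := 0) (r := 1)).subset fun a ha => ?_)
    rw [mem_closedBall_zero_iff, pi_norm_le_iff_of_nonneg zero_le_one]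
    intro i
    have : a i ^ 2 ≤ l2sq a :=
      Finset.single_le_sum (f := fun j => a j ^ 2) (fun j _ => sq_nonneg _) (Finset.mem_univ i)
    rw [Set.mem_ofPred_eq] at ha
    exact abs_le_one_iff_mul_self_le_one.mpr (by nlinarith)
  have hne : {a : Fin r → ℝ | l2sq a = 1}.Nonempty :=
    ⟨Pi.single ⟨0, hr⟩ 1, by simp [l2sq, Pi.single_apply]⟩
  obtain ⟨m, hm1, hmax⟩ := hcompact.exists_isMaxOn hne hcont.continuousOn
  set S := |quarticDev θ Y m| with hS
  have hS0 : 0 ≤ S := abs_nonneg _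
  have hall : ∀ a : Fin r → ℝ, |quarticDev θ Y a| ≤ S * (l2sq a) ^ 2 := by
    intro a
    rcases eq_or_ne (l2sq a) 0 with h | h
    · rw [l2sq_eq_zero h]
      simp [quarticDev, l4p4, l2sq]
    · have hpos : 0 < l2sq a := lt_of_le_of_ne (l2sq_nonneg a) h.symm
      have hs : 0 < √(l2sq a) := sqrt_pos.mpr hpos
      have hu : l2sq ((√(l2sq a))⁻¹ • a) = 1 := by
        rw [l2sq_smul, inv_pow, sq_sqrt hpos.le, inv_mul_cancel₀ h]
      have ha : a = √(l2sq a) • ((√(l2sq a))⁻¹ • a) := by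
        rw [smul_smul, mul_inv_cancel₀ hs.ne', one_smul]
      have h4 : √(l2sq a) ^ 4 = (l2sq a) ^ 2 := by
        rw [show (4 : ℕ) = 2 * 2 from rfl, pow_mul, sq_sqrt hpos.le]
      have hmx : |quarticDev θ Y ((√(l2sq a))⁻¹ • a)| ≤ S := hmax hu
      conv_lhs => rw [ha]
      rw [quarticDev_smul, h4, abs_mul, abs_of_nonneg (sq_nonneg _), mul_comm]
      exact mul_le_mul_of_nonneg_right hmx (sq_nonneg _)
  obtain ⟨b, hb, hmb, hδ⟩ := hnet m hm1
  have hw : l2sq ((100 : ℝ) • (m - b)) ≤ 1 := by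
    rw [l2sq_smul]; linarith
  have hm : m = b + (1 / 100 : ℝ) • ((100 : ℝ) • (m - b)) := by
    rw [smul_smul]; norm_num
  have hid := quarticDev_interpolation θ Y b ((100 : ℝ) • (m - b))
  rw [← hm] at hid
  have hbound : ∀ t : ℝ, |quarticDev θ Y (b + t • ((100 : ℝ) • (m - b)))|
      ≤ S * (6 / 5 + |t|) ^ 4 := fun t =>
    (hall _).trans (mul_le_mul_of_nonneg_left (l2sq_add_smul_sq_le hb hw t) hS0)
  have hkey : S ≤ 3 * δ := by
    have b1 := abs_le.mp (hbound 1)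
    have b2 := abs_le.mp (hbound (-1))
    have b3 := abs_le.mp (hbound 2)
    have b4 := abs_le.mp (hbound (-2))
    have b0 := abs_le.mp hδ
    norm_num at b1 b2 b3 b4
    have : S ≤ δ + (3 / 5) * S := by
      rw [hS, abs_le, ← hS]
      constructor <;> rw [hid] <;> norm_num <;> linarith
    linarith
  exact (hall a).trans (mul_le_mul_of_nonneg_right hkey (sq_nonneg _))

/-- The normalized fourth power of `b ⬝ᵥ x`, truncated to the ball `l2sq x < R`. -/
def truncQuartic {r : ℕ} (θ R : ℝ) (b : Fin r → ℝ) : (Fin r → ℝ) → ℝ :=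
  Set.indicator {x | l2sq x < R} fun x => (b ⬝ᵥ x) ^ 4 / (3 * θ)

lemma measurableSet_l2sq_lt {r : ℕ} (R : ℝ) : MeasurableSet {x : Fin r → ℝ | l2sq x < R} := by
  refine measurableSet_lt ?_ measurable_const
  unfold l2sq; fun_prop

lemma measurable_truncQuartic {r : ℕ} (θ R : ℝ) (b : Fin r → ℝ) :
    Measurable (truncQuartic θ R b) := by
  refine Measurable.indicator ?_ (measurableSet_l2sq_lt R)
  unfold dotProduct; fun_prop

lemma truncQuartic_nonneg {r : ℕ} {θ : ℝ} (h0 : 0 < θ) (R : ℝ) (b x : Fin r → ℝ) :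
    0 ≤ truncQuartic θ R b x :=
  Set.indicator_nonneg (fun x _ => by positivity) x

lemma truncQuartic_le {r : ℕ} {θ R : ℝ} (h0 : 0 < θ) {b : Fin r → ℝ} (hb : l2sq b ≤ 2)
    (x : Fin r → ℝ) : truncQuartic θ R b x ≤ 4 * R ^ 2 / (3 * θ) := by
  refine Set.indicator_apply_le' (fun hx => ?_) fun _ => by positivity
  have hx' : l2sq x < R := hx
  gcongr
  have h : (b ⬝ᵥ x) ^ 2 ≤ l2sq b * l2sq x := Finset.sum_mul_sq_le_sq_mul_sq _ _ _
  have h2 : (b ⬝ᵥ x) ^ 2 ≤ 2 * R :=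
    h.trans (mul_le_mul hb hx'.le (l2sq_nonneg x) (by norm_num))
  nlinarith [sq_nonneg (b ⬝ᵥ x)]

lemma truncQuartic_sq_le {r : ℕ} {θ R : ℝ} (b x : Fin r → ℝ) :
    truncQuartic θ R b x ^ 2 ≤ (b ⬝ᵥ x) ^ 8 / (9 * θ ^ 2) := by
  by_cases hx : x ∈ {x | l2sq x < R}
  · rw [truncQuartic, Set.indicator_of_mem hx]
    exact le_of_eq (by ring)
  · rw [truncQuartic, Set.indicator_of_notMem hx, zero_pow two_ne_zero]
    positivity

lemma isProbabilityMeasure_bgVec (r : ℕ) {θ : ℝ} (s : ℝ) (h0 : 0 ≤ θ) (h1 : θ ≤ 1) :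
    IsProbabilityMeasure (bgVec r θ s) := by
  have := isProbabilityMeasure_bgLaw s h0 h1
  unfold bgVec; infer_instance

lemma integrable_truncQuartic {r : ℕ} {θ R : ℝ} (h0 : 0 < θ) (h1 : θ ≤ 1 / 9) {b : Fin r → ℝ}
    (hb : l2sq b ≤ 2) : Integrable (truncQuartic θ R b) (bgVec r θ 1) := by
  have := isProbabilityMeasure_bgVec r 1 h0.le (by linarith : θ ≤ 1)
  refine .of_bound (measurable_truncQuartic θ R b).aestronglyMeasurable (4 * R ^ 2 / (3 * θ))
    (.of_forall fun x => ?_)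
  rw [norm_of_nonneg (truncQuartic_nonneg h0 R b x)]
  exact truncQuartic_le h0 hb x

lemma measure_truncQuartic_deviation_le {r n : ℕ} (hn : 0 < n) {θ R : ℝ} (h0 : 0 < θ)
    (h1 : θ ≤ 1 / 9) (hR : 0 < R) {b : Fin r → ℝ} (hb : l2sq b ≤ 2) {L : ℝ} (hL : 0 < L) :
    (Measure.pi fun _ : Fin n => bgVec r θ 1).real
      {Y | n * (2 * √(13440 / θ * L / n) + 2 * (4 * R ^ 2 / (3 * θ) * L / n)) ≤
        |∑ k, (truncQuartic θ R b (Y k) - ∫ x, truncQuartic θ R b x ∂(bgVec r θ 1))|}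
      ≤ 2 * exp (-L) := by
  have := isProbabilityMeasure_bgVec r 1 h0.le (by linarith : θ ≤ 1)
  set f := truncQuartic θ R b with hf
  set M := 4 * R ^ 2 / (3 * θ) with hMdef
  have hM0 : 0 < M := by positivity
  have hfi : Integrable f (bgVec r θ 1) := integrable_truncQuartic h0 h1 hb
  set m := ∫ x, f x ∂(bgVec r θ 1) with hm
  have hf0 : ∀ x, 0 ≤ f x := truncQuartic_nonneg h0 R b
  have hfM : ∀ x, f x ≤ M := truncQuartic_le h0 hb
  have hm0 : 0 ≤ m := integral_nonneg hf0
  have hmM : m ≤ M := by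
    refine (integral_mono hfi (integrable_const M) hfM).trans (le_of_eq (by simp))
  have hgM : ∀ x, |f x - m| ≤ M := fun x => by
    rw [abs_le]; constructor <;> linarith [hf0 x, hfM x]
  obtain ⟨h8i, h8⟩ := pow_eight_bgVec h0.le h1 hb
  have hf2 : Integrable (fun x => f x ^ 2) (bgVec r θ 1) := by
    refine (h8i.div_const (9 * θ ^ 2)).mono'
      ((measurable_truncQuartic θ R b).pow_const 2).aestronglyMeasurable (.of_forall fun x => ?_)
    rw [norm_of_nonneg (sq_nonneg _)]
    exact truncQuartic_sq_le b x
  have hvar : ∫ x, (f x - m) ^ 2 ∂(bgVec r θ 1) ≤ 13440 / θ := by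
    have e1 : ∫ x, (f x - m) ^ 2 ∂(bgVec r θ 1) = ∫ x, f x ^ 2 ∂(bgVec r θ 1) - m ^ 2 := by
      have : ∀ x, (f x - m) ^ 2 = f x ^ 2 - (2 * m * f x - m ^ 2) := fun x => by ring
      simp only [this]
      rw [integral_sub hf2 (by exact (hfi.const_mul _).sub (integrable_const _)),
        integral_sub (hfi.const_mul _) (integrable_const _), integral_const_mul, ← hm]
      simp
      ring
    have e2 : ∫ x, f x ^ 2 ∂(bgVec r θ 1) ≤ 120960 * θ / (9 * θ ^ 2) := by
      refine (integral_mono hf2 (h8i.div_const (9 * θ ^ 2)) (truncQuartic_sq_le b)).trans ?_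
      rw [integral_div]
      gcongr
    have e3 : 120960 * θ / (9 * θ ^ 2) = 13440 / θ := by field_simp; norm_num
    rw [e1]
    nlinarith
  have hcent : ∫ x, (f x - m) ∂(bgVec r θ 1) = 0 := by
    rw [integral_sub hfi (integrable_const _)]; simp [hm]
  have hmeas : Measurable fun x => f x - m := (measurable_truncQuartic θ R b).sub_const m
  have up := bernstein_inequality hn hmeas hgM hM0 hcent hvar (by positivity) hL
  have down := bernstein_inequality (g := fun x => -(f x - m)) hn hmeas.neg
    (fun x => by rw [abs_neg]; exact hgM x) hM0 (by rw [integral_neg, hcent, neg_zero])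
    (by simpa only [neg_sq] using hvar) (by positivity) hL
  have habs : ∀ c : ℝ, {Y : Fin n → Fin r → ℝ | c ≤ |∑ k, (f (Y k) - m)|}
      ⊆ {Y | c ≤ ∑ k, (f (Y k) - m)} ∪ {Y | c ≤ ∑ k, -(f (Y k) - m)} := by
    intro c Y hY
    rcases le_abs.mp (Set.mem_ofPred.mp hY) with h | h
    · exact Or.inl h
    · right
      rw [Set.mem_ofPred, Finset.sum_neg_distrib]
      exact h
  refine (measureReal_mono (habs _)).trans ((measureReal_union_le _ _).trans ?_)
  linarith

lemma abs_integral_truncQuartic_sub_le {r n : ℕ} (hn : 0 < n) {θ R : ℝ} (h0 : 0 < θ)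
    (h1 : θ ≤ 1 / 9) {b : Fin r → ℝ} (hb : l2sq b ≤ 2)
    (hR : exp (θ * r / 2 - R / 4) ≤ 1 / (n : ℝ) ^ 3) :
    |∫ x, truncQuartic θ R b x ∂(bgVec r θ 1) - ((1 - θ) * l4p4 b + θ * (l2sq b) ^ 2)|
      ≤ 2241 / (θ * n) := by
  have hn' : (1 : ℝ) ≤ n := by exact_mod_cast hn
  have := isProbabilityMeasure_bgVec r 1 h0.le (by linarith : θ ≤ 1)
  obtain ⟨h4i, h4⟩ := pow_four_bgVec h0.le (by linarith) b
  obtain ⟨h8i, h8⟩ := pow_eight_bgVec h0.le h1 hb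
  have hS : MeasurableSet {x : Fin r → ℝ | R ≤ l2sq x} := by
    convert (measurableSet_l2sq_lt R).compl using 1
    ext x; simp
  have hind : Integrable (Set.indicator {x : Fin r → ℝ | R ≤ l2sq x} fun _ => (n : ℝ))
      (bgVec r θ 1) := (integrable_const _).indicator hS
  have hpt : ∀ x, |truncQuartic θ R b x - (b ⬝ᵥ x) ^ 4 / (3 * θ)|
      ≤ ((b ⬝ᵥ x) ^ 8 / n + Set.indicator {x : Fin r → ℝ | R ≤ l2sq x} (fun _ => (n : ℝ)) x)
        / (6 * θ) := by
    intro x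
    by_cases hx : l2sq x < R
    · have h2 : x ∉ {x : Fin r → ℝ | R ≤ l2sq x} := not_le.mpr hx
      rw [truncQuartic, Set.indicator_of_mem (by exact hx), Set.indicator_of_notMem h2, sub_self,
        abs_zero]
      positivity
    · have h2 : x ∈ {x : Fin r → ℝ | R ≤ l2sq x} := not_lt.mp hx
      rw [truncQuartic, Set.indicator_of_notMem (by exact hx), Set.indicator_of_mem h2, zero_sub,
        abs_neg, abs_of_nonneg (by positivity), div_le_div_iff₀ (by positivity) (by positivity)]
      have : 2 * (b ⬝ᵥ x) ^ 4 ≤ (b ⬝ᵥ x) ^ 8 / n + n := by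
        have e : (b ⬝ᵥ x) ^ 8 / n + n - 2 * (b ⬝ᵥ x) ^ 4 = ((b ⬝ᵥ x) ^ 4 - n) ^ 2 / n := by
          field_simp; ring
        have : 0 ≤ ((b ⬝ᵥ x) ^ 4 - n) ^ 2 / n := by positivity
        linarith
      nlinarith
  have hmean : ((1 - θ) * l4p4 b + θ * (l2sq b) ^ 2)
      = ∫ x, (b ⬝ᵥ x) ^ 4 / (3 * θ) ∂(bgVec r θ 1) := by
    rw [integral_div, h4]; field_simp
  rw [hmean, ← integral_sub (integrable_truncQuartic h0 h1 hb) (h4i.div_const _)]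
  refine (abs_integral_le_integral_abs).trans ((integral_mono
    (((integrable_truncQuartic h0 h1 hb).sub (h4i.div_const _)).abs)
    (((h8i.div_const _).add hind).div_const _) hpt).trans ?_)
  have htail := (measure_l2sq_gt_bgVec_le (r := r) h0.le (by linarith : θ ≤ 1) R).trans hR
  simp only [Pi.add_apply]
  rw [integral_div, integral_add (h8i.div_const _) hind, integral_div, integral_indicator hS,
    setIntegral_const, smul_eq_mul, div_le_div_iff₀ (by positivity) (by positivity)]
  have e1 : (∫ x, (b ⬝ᵥ x) ^ 8 ∂(bgVec r θ 1)) / n * n ≤ 13440 := by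
    rw [div_mul_cancel₀ _ (by positivity)]; linarith
  have e2 : (bgVec r θ 1).real {x | R ≤ l2sq x} * n * n ≤ 1 := by
    have : (bgVec r θ 1).real {x | R ≤ l2sq x} * n * n ≤ 1 / (n : ℝ) ^ 3 * n * n := by gcongr
    refine this.trans ?_
    rw [show 1 / (n : ℝ) ^ 3 * n * n = 1 / n by field_simp]
    exact (div_le_one (by positivity)).mpr hn'
  nlinarith

lemma exists_grid_point {r n : ℕ} (hr : 1 ≤ r) (hrn : 100 * r ≤ n) {a : Fin r → ℝ}
    (ha : l2sq a = 1) :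
    ∃ z ∈ Fintype.piFinset fun _ : Fin r => Finset.Icc (-(n : ℤ)) n,
      l2sq (fun i => (z i : ℝ) / n) ≤ (6 / 5) ^ 2 ∧
      l2sq (a - fun i => (z i : ℝ) / n) ≤ 1 / 100 ^ 2 := by
  have hr' : (1 : ℝ) ≤ r := by exact_mod_cast hr
  have hrn' : 100 * (r : ℝ) ≤ n := by exact_mod_cast hrn
  have hn : (0 : ℝ) < n := by linarith
  have hai : ∀ i, -1 ≤ a i ∧ a i ≤ 1 := by
    intro i
    have : a i ^ 2 ≤ l2sq a :=
      Finset.single_le_sum (f := fun j => a j ^ 2) (fun j _ => sq_nonneg _) (Finset.mem_univ i)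
    exact abs_le.mp (abs_le_one_iff_mul_self_le_one.mpr (by nlinarith))
  have hround : ∀ i, (a i - (⌊a i * n⌋ : ℝ) / n) ^ 2 ≤ 1 / (n : ℝ) ^ 2 := by
    intro i
    have e : a i - (⌊a i * n⌋ : ℝ) / n = Int.fract (a i * n) / n := by
      rw [Int.fract]; field_simp
    rw [e, div_pow]
    have h0 := Int.fract_nonneg (a i * n)
    have h1 := (Int.fract_lt_one (a i * n)).le
    gcongr
    exact pow_le_one₀ h0 h1
  have hd : l2sq (a - fun i => (⌊a i * n⌋ : ℝ) / n) ≤ 1 / 100 ^ 2 := by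
    calc l2sq (a - fun i => (⌊a i * n⌋ : ℝ) / n) ≤ ∑ _i : Fin r, 1 / (n : ℝ) ^ 2 :=
          Finset.sum_le_sum fun i _ => hround i
      _ = r / (n : ℝ) ^ 2 := by simp; ring
      _ ≤ 1 / 100 ^ 2 := by
          rw [div_le_div_iff₀ (by positivity) (by norm_num)]
          nlinarith
  refine ⟨fun i => ⌊a i * n⌋, ?_, ?_, hd⟩
  · simp only [Fintype.mem_piFinset, Finset.mem_Icc]
    intro i
    constructor
    · rw [Int.le_floor]; push_cast; nlinarith [hai i]
    · exact Int.floor_le_iff.mpr (by push_cast; nlinarith [hai i])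
  · have : l2sq (fun i => (⌊a i * n⌋ : ℝ) / n)
        ≤ 11 / 10 * l2sq a + 11 * l2sq (a - fun i => (⌊a i * n⌋ : ℝ) / n) := by
      simp only [l2sq, Finset.mul_sum, ← Finset.sum_add_distrib, Pi.sub_apply]
      refine Finset.sum_le_sum fun i _ => ?_
      nlinarith [sq_nonneg (a i / 10 - ((⌊a i * n⌋ : ℝ) / n - a i))]
    linarith

/-- Radius of the quartic concentration bound. -/
def devRadius (r n : ℕ) (θ : ℝ) : ℝ :=
  2 * √(13440 / θ * (5 * r * log n) / n)
    + 2 * (4 * (2 * θ * r + 12 * log n) ^ 2 / (3 * θ) * (5 * r * log n) / n) + 2241 / (θ * n)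

lemma measure_quarticDev_gt_le {r n : ℕ} (hr : 1 ≤ r) (hn2 : 2 ≤ n) (hrn : 100 * r ≤ n) {θ : ℝ}
    (h0 : 0 < θ) (h1 : θ ≤ 1 / 9) :
    (Measure.pi fun _ : Fin n => bgVec r θ 1).real
      {Y | ¬ ∀ a, |quarticDev θ Y a| ≤ 3 * devRadius r n θ * (l2sq a) ^ 2} ≤ 3 / (n : ℝ) ^ 2 := by
  have := isProbabilityMeasure_bgVec r 1 h0.le (by linarith : θ ≤ 1)
  have hr' : (1 : ℝ) ≤ r := by exact_mod_cast hr
  have hn' : (2 : ℝ) ≤ n := by exact_mod_cast hn2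
  have hlog : 0 < log n := log_pos (by linarith)
  set R := 2 * θ * r + 12 * log n with hRdef
  set L := 5 * r * log n with hLdef
  have hR0 : 0 < R := by positivity
  have hL0 : 0 < L := by positivity
  have hRexp : exp (θ * r / 2 - R / 4) ≤ 1 / (n : ℝ) ^ 3 := by
    have : θ * r / 2 - R / 4 = -(3 * log n) := by rw [hRdef]; ring
    rw [this, Real.exp_neg, mul_comm, exp_mul, exp_log (by linarith)]
    norm_num
  set t := 2 * √(13440 / θ * L / n) + 2 * (4 * R ^ 2 / (3 * θ) * L / n) with ht
  have hrad : devRadius r n θ = t + 2241 / (θ * n) := rfl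
  set Z := (Fintype.piFinset fun _ : Fin r => Finset.Icc (-(n : ℤ)) n).filter
    fun z => l2sq (fun i => (z i : ℝ) / n) ≤ (6 / 5) ^ 2 with hZ
  set bad : (Fin r → ℤ) → Set (Fin n → Fin r → ℝ) := fun z =>
    {Y | n * t ≤ |∑ k, (truncQuartic θ R (fun i => (z i : ℝ) / n) (Y k)
      - ∫ x, truncQuartic θ R (fun i => (z i : ℝ) / n) x ∂(bgVec r θ 1))|} with hbad
  have hsub : {Y : Fin n → Fin r → ℝ |
        ¬ ∀ a, |quarticDev θ Y a| ≤ 3 * devRadius r n θ * (l2sq a) ^ 2}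
      ⊆ (⋃ k, {Y | R ≤ l2sq (Y k)}) ∪ ⋃ z ∈ Z, bad z := by
    intro Y hY
    by_contra hcon
    refine hY (abs_quarticDev_le_of_net hr θ Y fun a ha => ?_)
    simp only [Set.mem_union, Set.mem_iUnion, not_or, not_exists] at hcon
    obtain ⟨hc1, hc2⟩ := hcon
    obtain ⟨z, hz, hzb, hza⟩ := exists_grid_point hr hrn ha
    set b : Fin r → ℝ := fun i => (z i : ℝ) / n with hb
    have hgood := hc2 z (Finset.mem_filter.mpr ⟨hz, hzb⟩)
    have hb2 : l2sq b ≤ 2 := hzb.trans (by norm_num)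
    refine ⟨b, hzb, hza, ?_⟩
    have htr : ∀ k, truncQuartic θ R b (Y k) = (b ⬝ᵥ Y k) ^ 4 / (3 * θ) := fun k =>
      Set.indicator_of_mem (s := {x | l2sq x < R})
        (show l2sq (Y k) < R from not_le.mp fun h => hc1 k h) _
    have hdev : |∑ k, (truncQuartic θ R b (Y k) - ∫ x, truncQuartic θ R b x ∂(bgVec r θ 1))|
        ≤ n * t := (not_le.mp hgood).le
    set μ := ∫ x, truncQuartic θ R b x ∂(bgVec r θ 1) with hμ
    have hbias := abs_integral_truncQuartic_sub_le (n := n) (by omega) h0 h1 hb2 hRexp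
    rw [← hμ] at hbias
    have hsum : ∑ k, (truncQuartic θ R b (Y k) - μ)
        = n * ((∑ k, (b ⬝ᵥ Y k) ^ 4) / (3 * θ * n) - μ) := by
      rw [Finset.sum_sub_distrib]
      simp only [htr, ← Finset.sum_div, Finset.sum_const, Finset.card_univ, Fintype.card_fin,
        nsmul_eq_mul]
      field_simp
    rw [hsum, abs_mul, Nat.abs_cast, mul_le_mul_iff_right₀ (by linarith)] at hdev
    have : quarticDev θ Y b = ((∑ k, (b ⬝ᵥ Y k) ^ 4) / (3 * θ * n) - μ)
        + (μ - ((1 - θ) * l4p4 b + θ * (l2sq b) ^ 2)) := by unfold quarticDev; ring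
    rw [this, hrad]
    exact (abs_add_le _ _).trans (add_le_add hdev hbias)
  have hfirst : (Measure.pi fun _ : Fin n => bgVec r θ 1).real (⋃ k, {Y | R ≤ l2sq (Y k)})
      ≤ 1 / (n : ℝ) ^ 2 := by
    refine (measureReal_iUnion_fintype_le _).trans ?_
    have hk : ∀ k : Fin n, (Measure.pi fun _ : Fin n => bgVec r θ 1).real {Y | R ≤ l2sq (Y k)}
        ≤ 1 / (n : ℝ) ^ 3 := by
      intro k
      have hS : MeasurableSet {x : Fin r → ℝ | R ≤ l2sq x} := by
        convert (measurableSet_l2sq_lt R).compl using 1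
        ext x; simp
      have hp := (measurePreserving_eval (fun _ : Fin n => bgVec r θ 1) k).measureReal_preimage
        hS.nullMeasurableSet
      refine (le_of_eq hp).trans ?_
      exact (measure_l2sq_gt_bgVec_le h0.le (by linarith) R).trans hRexp
    refine (Finset.sum_le_sum fun k _ => hk k).trans (le_of_eq ?_)
    simp only [Finset.sum_const, Finset.card_univ, Fintype.card_fin, nsmul_eq_mul]
    field_simp
  have hcard : (Z.card : ℝ) ≤ exp (3 * r * log n) := by
    have h1 : Z.card ≤ (2 * n + 1) ^ r := by
      refine (Finset.card_filter_le _ _).trans (le_of_eq ?_)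
      rw [Fintype.card_piFinset]
      simp only [Int.card_Icc, Finset.prod_const, Finset.card_univ, Fintype.card_fin]
      congr 1
      omega
    have h2 : ((2 * n + 1 : ℕ) : ℝ) ≤ (n : ℝ) ^ 3 := by push_cast; nlinarith [sq_nonneg (n : ℝ)]
    have h3 : exp (3 * r * log n) = ((n : ℝ) ^ 3) ^ r := by
      rw [← pow_mul, mul_comm (3 * (r : ℝ)), exp_mul, exp_log (by linarith)]
      exact_mod_cast rpow_natCast (n : ℝ) (3 * r)
    rw [h3]
    calc (Z.card : ℝ) ≤ ((2 * n + 1 : ℕ) : ℝ) ^ r := by exact_mod_cast h1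
      _ ≤ _ := pow_le_pow_left₀ (by positivity) h2 r
  have hsecond : (Measure.pi fun _ : Fin n => bgVec r θ 1).real (⋃ z ∈ Z, bad z)
      ≤ 2 / (n : ℝ) ^ 2 := by
    refine (measureReal_biUnion_finset_le _ _).trans ?_
    refine (Finset.sum_le_sum fun z hz => measure_truncQuartic_deviation_le (by omega) h0 h1 hR0
      (((Finset.mem_filter.mp hz).2).trans (by norm_num)) hL0).trans ?_
    rw [Finset.sum_const, nsmul_eq_mul]
    calc (Z.card : ℝ) * (2 * exp (-L)) ≤ exp (3 * r * log n) * (2 * exp (-L)) := by gcongr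
      _ = 2 * exp (-(r * (2 * log n))) := by
          rw [mul_left_comm, ← exp_add]; congr 2; rw [hLdef]; ring
      _ ≤ 2 * exp (-(2 * log n)) :=
          mul_le_mul_of_nonneg_left (exp_le_exp.mpr (by nlinarith)) (by norm_num)
      _ = 2 / (n : ℝ) ^ 2 := by
          rw [Real.exp_neg, mul_comm 2 (log _), exp_mul, exp_log (by linarith)]
          norm_num; rfl
  calc _ ≤ _ := measureReal_mono hsub
    _ ≤ _ := measureReal_union_le _ _
    _ ≤ 1 / (n : ℝ) ^ 2 + 2 / (n : ℝ) ^ 2 := add_le_add hfirst hsecond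
    _ = 3 / (n : ℝ) ^ 2 := by ring

lemma map_transpose_pi {α : Type*} [MeasurableSpace α] (μ : Measure α) [IsProbabilityMeasure μ]
    (r n : ℕ) :
    (Measure.pi fun _ : Fin r => Measure.pi fun _ : Fin n => μ).map (fun X k i => X i k)
      = Measure.pi fun _ : Fin n => Measure.pi fun _ : Fin r => μ := by
  simp only [← Measure.infinitePi_eq_pi]
  rw [← Measure.infinitePi_map_curry (fun (_ : Fin r) (_ : Fin n) => μ),
    ← Measure.infinitePi_map_curry (fun (_ : Fin n) (_ : Fin r) => μ),
    Measure.map_map (by fun_prop) (by fun_prop),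
    ← Measure.map_infinitePi_infinitePi_of_inj (P := fun _ : Fin r × Fin n => μ)
      (Prod.swap_injective (α := Fin n) (β := Fin r)),
    Measure.map_map (by fun_prop) (by fun_prop)]
  rfl

lemma map_bgMatrix {r n : ℕ} {θ σ : ℝ} (h0 : 0 ≤ θ) (h1 : θ ≤ 1) (hσ : 0 < σ) :
    (bgMatrix r n θ (σ ^ 2)).map (fun X k i => σ⁻¹ * X i k)
      = Measure.pi fun _ : Fin n => bgVec r θ 1 := by
  have := isProbabilityMeasure_bgLaw (σ ^ 2) h0 h1
  have := isProbabilityMeasure_bgLaw 1 h0 h1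
  have hlaw : (bgLaw θ (σ ^ 2)).map (fun x => σ⁻¹ * x) = bgLaw θ 1 := by
    rw [bgLaw_sq, Measure.map_map (by fun_prop) (by fun_prop)]
    convert Measure.map_id
    ext x
    simp [hσ.ne']
  have hvec : ∀ m : ℕ, (Measure.pi fun _ : Fin m => bgLaw θ (σ ^ 2)).map
      (fun x i => σ⁻¹ * x i) = Measure.pi fun _ : Fin m => bgLaw θ 1 := by
    intro m
    rw [Measure.pi_map_pi (f := fun _ x => σ⁻¹ * x) fun _ => by fun_prop]
    simp only [hlaw]
  have hcomp : (fun (X : Fin r → Fin n → ℝ) k i => σ⁻¹ * X i k)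
      = (fun (Y : Fin n → Fin r → ℝ) k => (fun (x : Fin r → ℝ) i => σ⁻¹ * x i) (Y k))
        ∘ (fun X k i => X i k) := rfl
  rw [hcomp, ← Measure.map_map (by fun_prop) (by fun_prop), bgMatrix, map_transpose_pi,
    Measure.pi_map_pi (f := fun _ (x : Fin r → ℝ) i => σ⁻¹ * x i) fun _ =>
      (by fun_prop : Measurable fun (x : Fin r → ℝ) i => σ⁻¹ * x i).aemeasurable]
  simp only [hvec, bgVec]

section CriticalPoints

variable {p r n : ℕ} {θ σ : ℝ} {A : Matrix (Fin p) (Fin r) ℝ} {X : Matrix (Fin r) (Fin n) ℝ}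
  {q : Fin p → ℝ}

lemma l2sq_eq_dotProduct {m : ℕ} (v : Fin m → ℝ) : l2sq v = v ⬝ᵥ v := by
  simp [l2sq, dotProduct, sq]

lemma proj_mulVec (q v : Fin p → ℝ) : proj q *ᵥ v = v - (q ⬝ᵥ v) • q := by
  rw [proj, Matrix.sub_mulVec, Matrix.one_mulVec, Matrix.vecMulVec_mulVec]
  ext i
  simp [mul_comm]

lemma dotProduct_mulVec_eq_zeta (A : Matrix (Fin p) (Fin r) ℝ) (q : Fin p → ℝ) (x : Fin r → ℝ) :
    q ⬝ᵥ (A *ᵥ x) = zeta A q ⬝ᵥ x := by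
  rw [zeta, Matrix.mulVec_transpose, Matrix.dotProduct_mulVec]

lemma zeta_mulVec (hA : Aᵀ * A = 1) (x : Fin r → ℝ) : zeta A (A *ᵥ x) = x := by
  rw [zeta, Matrix.mulVec_mulVec, hA, Matrix.one_mulVec]

lemma l2sq_sub_mulVec_zeta (hA : Aᵀ * A = 1) (hq : l2sq q = 1) :
    l2sq (q - A *ᵥ zeta A q) = 1 - l2sq (zeta A q) := by
  have h1 : q ⬝ᵥ (A *ᵥ zeta A q) = l2sq (zeta A q) := by
    rw [dotProduct_mulVec_eq_zeta, l2sq_eq_dotProduct]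
  have h2 : (A *ᵥ zeta A q) ⬝ᵥ (A *ᵥ zeta A q) = l2sq (zeta A q) := by
    rw [dotProduct_mulVec_eq_zeta, zeta_mulVec hA, l2sq_eq_dotProduct]
  rw [l2sq_eq_dotProduct] at hq ⊢
  rw [sub_dotProduct, dotProduct_sub, dotProduct_sub,
    dotProduct_comm (A *ᵥ zeta A q) q, h1, h2, hq]
  ring

/-- Stationarity of `q`, tested against an arbitrary direction `w`. -/
lemma sum_pow_three_mul_eq_of_gradF_eq_zero (hθ : θ ≠ 0) (hσ : σ ≠ 0) (hn : n ≠ 0)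
    (hg : gradF θ σ A X q = 0) (w : Fin p → ℝ) :
    ∑ k, (zeta A q ⬝ᵥ colX X k) ^ 3 * (zeta A w ⬝ᵥ colX X k)
      = (∑ k, (zeta A q ⬝ᵥ colX X k) ^ 4) * (w ⬝ᵥ q) := by
  have hc : -(1 / (3 * θ * σ ^ 4 * n)) ≠ 0 := by simp [hθ, hσ, hn]
  have h := (smul_eq_zero.mp hg).resolve_left hc
  rw [proj_mulVec, sub_eq_zero] at h
  have hw := congrArg (fun v => w ⬝ᵥ v) h
  simp only [dotProduct_smul, dotProduct_sum, smul_eq_mul, dotProduct_mulVec_eq_zeta] at hw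
  rw [hw]
  simp only [← pow_succ]

/-- The second-order condition at `q` in a tangent direction `v`. -/
lemma sum_sq_mul_sq_le_of_hessF_nonneg (hθ : 0 < θ) (hσ : 0 < σ) (hn : 0 < n)
    {v : Fin p → ℝ} (hv : v ⬝ᵥ q = 0) (hh : 0 ≤ qform (hessF θ σ A X q) v) :
    3 * ∑ k, (zeta A q ⬝ᵥ colX X k) ^ 2 * (zeta A v ⬝ᵥ colX X k) ^ 2
      ≤ (∑ k, (zeta A q ⬝ᵥ colX X k) ^ 4) * l2sq v := by
  have hn' : (0 : ℝ) < n := by exact_mod_cast hn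
  have hc : 0 < 1 / (3 * θ * σ ^ 4 * n) := by positivity
  have hPv : proj q *ᵥ v = v := by rw [proj_mulVec, dotProduct_comm, hv]; simp
  have hvP : ∀ y, v ⬝ᵥ (proj q *ᵥ y) = v ⬝ᵥ y := by
    intro y
    rw [proj_mulVec, dotProduct_sub, dotProduct_smul, hv]; simp
  have hform : qform (hessF θ σ A X q) v = -(1 / (3 * θ * σ ^ 4 * n)) *
      (3 * ∑ k, (zeta A q ⬝ᵥ colX X k) ^ 2 * (zeta A v ⬝ᵥ colX X k) ^ 2
        - (∑ k, (zeta A q ⬝ᵥ colX X k) ^ 4) * l2sq v) := by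
    rw [qform, hessF, Matrix.smul_mulVec, dotProduct_smul, smul_eq_mul, Matrix.sum_mulVec,
      dotProduct_sum]
    congr 1
    rw [Finset.mul_sum, Finset.sum_mul, ← Finset.sum_sub_distrib]
    refine Finset.sum_congr rfl fun k _ => ?_
    rw [← Matrix.mulVec_mulVec, ← Matrix.mulVec_mulVec, hPv, hvP, Matrix.sub_mulVec,
      Matrix.smul_mulVec, Matrix.smul_mulVec, Matrix.one_mulVec, Matrix.vecMulVec_mulVec,
      dotProduct_sub, dotProduct_smul, dotProduct_smul, l2sq_eq_dotProduct]
    simp only [smul_eq_mul, op_smul_eq_smul, dotProduct_smul]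
    rw [dotProduct_comm _ v]
    simp only [dotProduct_mulVec_eq_zeta]
    ring
  rw [hform] at hh
  nlinarith

end CriticalPoints

/-- Polarization of the quartic deviation at `ζ` along a coordinate direction. -/
lemma abs_sum_sq_mul_sq_sub_le {r n : ℕ} {θ Δ : ℝ} {Y : Fin n → Fin r → ℝ}
    (hY : ∀ a, |quarticDev θ Y a| ≤ Δ * (l2sq a) ^ 2) {ζ : Fin r → ℝ} (hζ : l2sq ζ ≤ 1)
    (hΔ : 0 ≤ Δ) (i : Fin r) :
    |(∑ k, (ζ ⬝ᵥ Y k) ^ 2 * (Y k i) ^ 2) / (3 * θ * n)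
      - ((1 - θ) * ζ i ^ 2 + θ / 3 * (l2sq ζ + 2 * ζ i ^ 2))| ≤ 3 * Δ := by
  set e : Fin r → ℝ := Pi.single i 1 with he
  have heY : ∀ k, e ⬝ᵥ Y k = Y k i := fun k => by simp [he]
  have hl2 : ∀ c : ℝ, l2sq (ζ + c • e) = l2sq ζ + 2 * c * ζ i + c ^ 2 := by
    intro c
    simp only [l2sq_eq_dotProduct, add_dotProduct, dotProduct_add, smul_dotProduct,
      dotProduct_smul, smul_eq_mul]
    simp [he]; ring
  have hl4 : ∀ c : ℝ, l4p4 (ζ + c • e)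
      = l4p4 ζ + 4 * c * ζ i ^ 3 + 6 * c ^ 2 * ζ i ^ 2 + 4 * c ^ 3 * ζ i + c ^ 4 := by
    intro c
    have : ∀ j, (ζ + c • e) j ^ 4 = ζ j ^ 4 + (if j = i then
        4 * c * ζ i ^ 3 + 6 * c ^ 2 * ζ i ^ 2 + 4 * c ^ 3 * ζ i + c ^ 4 else 0) := by
      intro j
      by_cases h : j = i
      · subst h; simp [he]; ring
      · simp [he, h]
    simp only [l4p4, this, Finset.sum_add_distrib, Finset.sum_ite_eq', Finset.mem_univ, if_true]
    ring
  have he2 : l2sq e = 1 := by simp [l2sq_eq_dotProduct, he]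
  have he4 : l4p4 e = 1 := by
    simp [l4p4, he, Pi.single_apply, ite_pow]
  have hi : ζ i ^ 2 ≤ l2sq ζ :=
    Finset.single_le_sum (f := fun j => ζ j ^ 2) (fun j _ => sq_nonneg _) (Finset.mem_univ i)
  have hiabs : |ζ i| ≤ 1 := abs_le_one_iff_mul_self_le_one.mpr (by nlinarith)
  obtain ⟨hi1, hi2⟩ := abs_le.mp hiabs
  have hsum : ∑ k, ((ζ + (1 : ℝ) • e) ⬝ᵥ Y k) ^ 4 + ∑ k, ((ζ + (-1 : ℝ) • e) ⬝ᵥ Y k) ^ 4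
      - 2 * ∑ k, (ζ ⬝ᵥ Y k) ^ 4 - 2 * ∑ k, (e ⬝ᵥ Y k) ^ 4
      = 12 * ∑ k, (ζ ⬝ᵥ Y k) ^ 2 * (Y k i) ^ 2 := by
    simp only [Finset.mul_sum, ← Finset.sum_add_distrib, ← Finset.sum_sub_distrib]
    refine Finset.sum_congr rfl fun k _ => ?_
    rw [add_dotProduct, add_dotProduct, smul_dotProduct, smul_dotProduct, heY]
    simp only [smul_eq_mul]
    ring
  have hpol : 12 * ((∑ k, (ζ ⬝ᵥ Y k) ^ 2 * (Y k i) ^ 2) / (3 * θ * n)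
      - ((1 - θ) * ζ i ^ 2 + θ / 3 * (l2sq ζ + 2 * ζ i ^ 2)))
      = quarticDev θ Y (ζ + (1 : ℝ) • e) + quarticDev θ Y (ζ + (-1 : ℝ) • e)
        - 2 * quarticDev θ Y ζ - 2 * quarticDev θ Y e := by
    rw [mul_sub, ← mul_div_assoc, ← hsum]
    simp only [quarticDev, hl2, hl4, he2, he4]
    ring
  have b1 := hY (ζ + (1 : ℝ) • e)
  have b2 := hY (ζ + (-1 : ℝ) • e)
  have b3 := hY ζ
  have b4 := hY e
  rw [hl2] at b1 b2
  rw [he2] at b4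
  have hz0 := l2sq_nonneg ζ
  have hsq : (l2sq ζ + 2 * 1 * ζ i + 1 ^ 2) ^ 2 + (l2sq ζ + 2 * (-1) * ζ i + (-1) ^ 2) ^ 2
      + 2 * (l2sq ζ) ^ 2 + 2 * 1 ^ 2 ≤ 36 := by nlinarith
  have hfin := mul_le_mul_of_nonneg_left hsq hΔ
  have := abs_le.mp b1
  have := abs_le.mp b2
  have := abs_le.mp b3
  have := abs_le.mp b4
  rw [abs_le]
  constructor <;> linarith

/-- A vector in the unit ball satisfying the first- and second-order conditions in a dominant
coordinate direction is close to that coordinate direction. -/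
lemma one_sub_sq_le_of_quarticDev {r n : ℕ} (hn : 0 < n) {θ Δ : ℝ} (hθ : 0 < θ) (hθ1 : θ ≤ 1 / 9)
    {Y : Fin n → Fin r → ℝ} (hY : ∀ a, |quarticDev θ Y a| ≤ Δ * (l2sq a) ^ 2) {ζ : Fin r → ℝ}
    (hζ : l2sq ζ ≤ 1) (hΔ : 0 ≤ Δ) {i : Fin r} (hmax : ∀ j, ζ j ^ 2 ≤ ζ i ^ 2)
    (hm : 100 * Δ < ζ i ^ 2) (hnorm : (∑ k, (ζ ⬝ᵥ Y k) ^ 4) * (1 - l2sq ζ) = 0)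
    (hhess : 3 * ∑ k, (ζ ⬝ᵥ Y k) ^ 2 * (Y k i) ^ 2
      ≤ (1 + 2 * ζ i ^ 2) * ∑ k, (ζ ⬝ᵥ Y k) ^ 4) :
    l2sq ζ = 1 ∧ 1 - ζ i ^ 2 ≤ 8 * Δ := by
  have hn' : (0 : ℝ) < n := by exact_mod_cast hn
  have hc : 0 < 3 * θ * n := by positivity
  have hT2 := abs_le.mp (abs_sum_sq_mul_sq_sub_le hY hζ hΔ i)
  have hz0 := l2sq_nonneg ζ
  have hone : l2sq ζ = 1 := by
    rcases mul_eq_zero.mp hnorm with h | h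
    · exfalso
      have h0 : ∑ k, (ζ ⬝ᵥ Y k) ^ 2 * (Y k i) ^ 2 = 0 := by
        refine le_antisymm (by rw [h] at hhess; linarith) (Finset.sum_nonneg fun k _ => ?_)
        positivity
      rw [h0, zero_div] at hT2
      nlinarith
    · linarith
  refine ⟨hone, ?_⟩
  set m := ζ i ^ 2 with hmdef
  have hm1 : m ≤ 1 := by
    rw [← hone]
    exact Finset.single_le_sum (f := fun j => ζ j ^ 2) (fun j _ => sq_nonneg _)
      (Finset.mem_univ i)
  have h4 : l4p4 ζ ≤ m := by
    calc l4p4 ζ ≤ ∑ j, m * ζ j ^ 2 := Finset.sum_le_sum fun j _ => by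
          nlinarith [hmax j, sq_nonneg (ζ j)]
      _ = m * l2sq ζ := by rw [← Finset.mul_sum]; rfl
      _ = m := by rw [hone, mul_one]
  have hT0 := (abs_le.mp (hY ζ)).2
  rw [quarticDev, hone] at hT0
  rw [hone] at hT2
  have hH : 3 * ((∑ k, (ζ ⬝ᵥ Y k) ^ 2 * (Y k i) ^ 2) / (3 * θ * n))
      ≤ (1 + 2 * m) * ((∑ k, (ζ ⬝ᵥ Y k) ^ 4) / (3 * θ * n)) := by
    rw [← mul_div_assoc, ← mul_div_assoc]
    gcongr
  set T2 := (∑ k, (ζ ⬝ᵥ Y k) ^ 2 * (Y k i) ^ 2) / (3 * θ * n)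
  set T0 := (∑ k, (ζ ⬝ᵥ Y k) ^ 4) / (3 * θ * n)
  have hm0 : 0 ≤ m := sq_nonneg _
  have hT0' : T0 ≤ (1 - θ) * m + θ + Δ := by nlinarith
  have hkey : 2 * (1 - θ) * (m * (1 - m)) ≤ 12 * Δ := by nlinarith
  have hkey2 : m * (1 - m) ≤ 27 / 4 * Δ := by nlinarith [mul_nonneg hm0 (sub_nonneg.mpr hm1)]
  have : 1 - m ≤ 27 / 400 := by
    by_contra hcon
    nlinarith
  nlinarith

/-- On the event of quartic concentration, second-order critical points with a large coefficient
are close to a signed column. -/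
lemma exists_l2sq_sub_col_le {p r n : ℕ} (hr : 1 ≤ r) (hn : 0 < n) {θ σ Δ cstar : ℝ} (hθ : 0 < θ)
    (hθ1 : θ ≤ 1 / 9) (hσ : 0 < σ) (hΔ : 0 ≤ Δ) (hΔc : 100 * Δ ≤ cstar)
    {A : Matrix (Fin p) (Fin r) ℝ} (hA : Aᵀ * A = 1) {X : Matrix (Fin r) (Fin n) ℝ}
    (hY : ∀ a, |quarticDev θ (fun k i => σ⁻¹ * X i k) a| ≤ Δ * (l2sq a) ^ 2)
    {q : Fin p → ℝ} (hq : l2sq q = 1) (hc : cstar < linfSq (zeta A q))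
    (hg : gradF θ σ A X q = 0)
    (hh : ∀ v : Fin p → ℝ, v ⬝ᵥ q = 0 → 0 ≤ qform (hessF θ σ A X q) v) :
    ∃ i : Fin r, l2sq (q - fun k => A k i) ≤ 16 * Δ ∨ l2sq (q + fun k => A k i) ≤ 16 * Δ := by
  have : Nonempty (Fin r) := ⟨⟨0, hr⟩⟩
  set ζ := zeta A q with hζdef
  obtain ⟨i, hi⟩ := exists_eq_ciSup_of_finite (f := fun j => ζ j ^ 2)
  have hmax : ∀ j, ζ j ^ 2 ≤ ζ i ^ 2 := fun j => by
    have := le_ciSup (Set.finite_range fun j => ζ j ^ 2).bddAbove j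
    rw [← hi] at this
    exact this
  have hmc : cstar < ζ i ^ 2 := by
    have : linfSq ζ = ζ i ^ 2 := hi.symm
    rwa [this] at hc
  have hle : l2sq ζ ≤ 1 := by
    have := l2sq_sub_mulVec_zeta hA hq
    have := l2sq_nonneg (q - A *ᵥ zeta A q)
    linarith
  set a : Fin p → ℝ := fun k => A k i with ha
  have hacol : a = A *ᵥ Pi.single i 1 := by ext k; simp [ha]
  have hza : zeta A a = Pi.single i 1 := by rw [hacol, zeta_mulVec hA]
  have haq : a ⬝ᵥ q = ζ i := by
    rw [dotProduct_comm, hacol, dotProduct_mulVec_eq_zeta]; simp [hζdef]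
  have haa : a ⬝ᵥ a = 1 := by
    nth_rewrite 2 [hacol]
    rw [dotProduct_mulVec_eq_zeta, hza]; simp
  have hqq : q ⬝ᵥ q = 1 := by rw [← l2sq_eq_dotProduct, hq]
  set S4 := ∑ k, (ζ ⬝ᵥ colX X k) ^ 4 with hS4
  have hzlin : ∀ (u w : Fin p → ℝ) (c : ℝ), zeta A (u - c • w) = zeta A u - c • zeta A w :=
    fun u w c => by simp only [zeta, Matrix.mulVec_sub, Matrix.mulVec_smul]
  have hgrad := sum_pow_three_mul_eq_of_gradF_eq_zero hθ.ne' hσ.ne' hn.ne' hg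
  have hnorm : S4 * (1 - l2sq ζ) = 0 := by
    have h := hgrad (q - (1 : ℝ) • (A *ᵥ ζ))
    have hz : zeta A (q - (1 : ℝ) • (A *ᵥ ζ)) = 0 := by
      rw [hzlin, zeta_mulVec hA, ← hζdef]; simp
    rw [hz] at h
    simp only [zero_dotProduct, mul_zero, Finset.sum_const_zero] at h
    rw [one_smul, sub_dotProduct, hqq, dotProduct_comm (A *ᵥ ζ) q,
      dotProduct_mulVec_eq_zeta, ← hζdef, ← l2sq_eq_dotProduct] at h
    exact h.symm
  have hgi : ∑ k, (ζ ⬝ᵥ colX X k) ^ 3 * X i k = S4 * ζ i := by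
    have h := hgrad a
    rw [haq, hza] at h
    simpa [colX] using h
  have hhess : 3 * ∑ k, (ζ ⬝ᵥ colX X k) ^ 2 * (X i k) ^ 2 ≤ (1 + 2 * ζ i ^ 2) * S4 := by
    have hv : (a - ζ i • q) ⬝ᵥ q = 0 := by
      rw [sub_dotProduct, smul_dotProduct, haq, hqq]; simp
    have h := sum_sq_mul_sq_le_of_hessF_nonneg hθ hσ hn hv (hh _ hv)
    have hvv : l2sq (a - ζ i • q) = 1 - ζ i ^ 2 := by
      rw [l2sq_eq_dotProduct, dotProduct_sub, dotProduct_smul, hv, sub_dotProduct,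
        smul_dotProduct, haa, dotProduct_comm q a, haq]
      simp [sq]
    rw [hvv, hzlin, hza, ← hζdef] at h
    have hexp : ∑ k, (ζ ⬝ᵥ colX X k) ^ 2 * ((Pi.single i 1 - ζ i • ζ) ⬝ᵥ colX X k) ^ 2
        = ∑ k, (ζ ⬝ᵥ colX X k) ^ 2 * (X i k) ^ 2
          - 2 * ζ i * ∑ k, (ζ ⬝ᵥ colX X k) ^ 3 * X i k + ζ i ^ 2 * S4 := by
      simp only [hS4, Finset.mul_sum, ← Finset.sum_add_distrib, ← Finset.sum_sub_distrib]
      refine Finset.sum_congr rfl fun k _ => ?_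
      rw [sub_dotProduct, smul_dotProduct, single_one_dotProduct]
      simp only [smul_eq_mul, colX]
      ring
    rw [hexp, hgi] at h
    nlinarith
  have hdot : ∀ k, ζ ⬝ᵥ (fun i => σ⁻¹ * X i k) = σ⁻¹ * (ζ ⬝ᵥ colX X k) := fun k =>
    dotProduct_smul σ⁻¹ ζ (colX X k)
  have hs4 : ∑ k, (ζ ⬝ᵥ fun i => σ⁻¹ * X i k) ^ 4 = (σ⁻¹) ^ 4 * S4 := by
    simp only [hdot, mul_pow, Finset.mul_sum, hS4]
  have hs2 : ∑ k, (ζ ⬝ᵥ fun i => σ⁻¹ * X i k) ^ 2 * (σ⁻¹ * X i k) ^ 2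
      = (σ⁻¹) ^ 4 * ∑ k, (ζ ⬝ᵥ colX X k) ^ 2 * (X i k) ^ 2 := by
    rw [Finset.mul_sum]
    exact Finset.sum_congr rfl fun k _ => by rw [hdot]; ring
  obtain ⟨hone, hres⟩ := one_sub_sq_le_of_quarticDev hn hθ hθ1 hY hle hΔ hmax (by linarith)
    (by rw [hs4, mul_assoc, hnorm, mul_zero])
    (by
      rw [hs4, hs2]
      have := mul_le_mul_of_nonneg_left hhess (by positivity : 0 ≤ (σ⁻¹) ^ 4)
      linarith)
  have hsub : l2sq (q - a) = 2 - 2 * ζ i := by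
    rw [l2sq_eq_dotProduct, dotProduct_sub, sub_dotProduct, sub_dotProduct, hqq, haa,
      dotProduct_comm q a, haq]
    ring
  have hadd : l2sq (q + a) = 2 + 2 * ζ i := by
    rw [l2sq_eq_dotProduct, dotProduct_add, add_dotProduct, add_dotProduct, hqq, haa,
      dotProduct_comm q a, haq]
    ring
  have him : ζ i ^ 2 ≤ 1 := by
    rw [← hone]
    exact Finset.single_le_sum (f := fun j => ζ j ^ 2) (fun j _ => sq_nonneg _)
      (Finset.mem_univ i)
  have hi1 := abs_le.mp (abs_le_one_iff_mul_self_le_one.mpr (by nlinarith : ζ i * ζ i ≤ 1))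
  refine ⟨i, ?_⟩
  rcases le_total 0 (ζ i) with h | h
  · left; rw [hsub]; nlinarith
  · right; rw [hadd]; nlinarith

/-- The estimation rate of the second-order critical points. -/
def criticalRate (r n : ℕ) (θ : ℝ) : ℝ :=
  √((r : ℝ) ^ 2 * log n / (θ * n)) + (θ * (r : ℝ) ^ 2 + (log n) ^ 2 / θ) * (r * log n / n)

lemma devRadius_nonneg {r n : ℕ} {θ : ℝ} (hθ : 0 < θ) : 0 ≤ devRadius r n θ := by
  have := log_natCast_nonneg n
  unfold devRadius
  positivity

lemma devRadius_le_criticalRate {r n : ℕ} (hr : 1 ≤ r) (hn : 2 ≤ n) {θ : ℝ} (hθ : 0 < θ) :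
    devRadius r n θ ≤ 11000 * criticalRate r n θ := by
  have hr' : (1 : ℝ) ≤ r := by exact_mod_cast hr
  have hn' : (2 : ℝ) ≤ n := by exact_mod_cast hn
  have hlog : 0.69 ≤ log n := by
    have := log_le_log (by norm_num) hn'
    linarith [log_two_gt_d9]
  set ℓ := log n
  have hn0 : (0 : ℝ) < n := by linarith
  have hℓ0 : 0 < ℓ := by linarith
  have hs : √(13440 / θ * (5 * r * ℓ) / n) ≤ 260 * √((r : ℝ) ^ 2 * ℓ / (θ * n)) := by
    rw [show (260 : ℝ) = √(260 ^ 2) from (sqrt_sq (by norm_num)).symm, ← sqrt_mul (by norm_num)]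
    refine sqrt_le_sqrt ?_
    have e1 : 13440 / θ * (5 * r * ℓ) / n = (67200 * r) * (ℓ / (θ * n)) := by field_simp; norm_num
    have e2 : (260 : ℝ) ^ 2 * ((r : ℝ) ^ 2 * ℓ / (θ * n)) = (67600 * r ^ 2) * (ℓ / (θ * n)) := by
      ring
    rw [e1, e2]
    exact mul_le_mul_of_nonneg_right (by nlinarith) (by positivity)
  set B := r * ℓ / n
  have hB : 0 < B := by positivity
  have hmid : 2 * (4 * (2 * θ * r + 12 * ℓ) ^ 2 / (3 * θ) * (5 * r * ℓ) / n)
      ≤ 3840 * ((θ * (r : ℝ) ^ 2 + ℓ ^ 2 / θ) * B) := by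
    have e1 : 2 * (4 * (2 * θ * r + 12 * ℓ) ^ 2 / (3 * θ) * (5 * r * ℓ) / n)
        = (40 / 3 * ((2 * θ * r + 12 * ℓ) ^ 2 / θ)) * B := by
      simp only [B]; field_simp; norm_num
    have e2 : 3840 * ((θ * (r : ℝ) ^ 2 + ℓ ^ 2 / θ) * B)
        = (3840 * ((θ ^ 2 * r ^ 2 + ℓ ^ 2) / θ)) * B := by field_simp
    rw [e1, e2]
    gcongr ?_ * B
    rw [← mul_div_assoc, ← mul_div_assoc]
    refine div_le_div_of_nonneg_right ?_ hθ.le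
    nlinarith [sq_nonneg (2 * θ * r - 12 * ℓ), sq_nonneg (θ * r)]
  have hlast : 2241 / (θ * n) ≤ 7000 * ((θ * (r : ℝ) ^ 2 + ℓ ^ 2 / θ) * B) := by
    calc 2241 / (θ * n) ≤ 7000 * (r * ℓ ^ 3) / (θ * n) := by
          gcongr
          have h2 : (0.69 : ℝ) ^ 3 ≤ ℓ ^ 3 := by gcongr
          nlinarith [pow_pos hℓ0 3]
      _ = 7000 * (ℓ ^ 2 / θ * B) := by simp only [B]; field_simp
      _ ≤ _ := by
          gcongr
          have : 0 ≤ θ * (r : ℝ) ^ 2 := by positivity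
          linarith
  have hs0 := sqrt_nonneg ((r : ℝ) ^ 2 * ℓ / (θ * n))
  have : 0 ≤ (θ * (r : ℝ) ^ 2 + ℓ ^ 2 / θ) * B := by positivity
  rw [devRadius, criticalRate]
  linarith

lemma criticalRate_le_of_sampleSize {r n : ℕ} (hr : 1 ≤ r) (hn : 2 ≤ n) {θ cstar : ℝ}
    (hθ : 0 < θ) (hθ1 : θ ≤ 1 / 9) (hc : 0 < cstar) (hc1 : cstar ≤ 1 / 4)
    (h : 10 ^ 14 * max ((r : ℝ) ^ 2 / cstar) ((log n) ^ 2) * (r * log n) / (θ * cstar) ≤ n) :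
    100 * r ≤ n ∧ 10 ^ 7 * criticalRate r n θ ≤ 3 * cstar := by
  have hr' : (1 : ℝ) ≤ r := by exact_mod_cast hr
  have hn' : (2 : ℝ) ≤ n := by exact_mod_cast hn
  have hlog : 0.69 ≤ log n := by
    have := log_le_log (by norm_num) hn'
    linarith [log_two_gt_d9]
  set ℓ := log n
  have hn0 : (0 : ℝ) < n := by linarith
  have hℓ0 : 0 < ℓ := by linarith
  have hA : 10 ^ 14 * ((r : ℝ) ^ 3 * ℓ) ≤ n * (θ * cstar ^ 2) := by
    have h1 : 10 ^ 14 * ((r : ℝ) ^ 2 / cstar) * (r * ℓ) / (θ * cstar) ≤ n :=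
      le_trans (by gcongr; exact le_max_left _ _) h
    rw [div_le_iff₀ (by positivity)] at h1
    calc 10 ^ 14 * ((r : ℝ) ^ 3 * ℓ)
        = (10 ^ 14 * ((r : ℝ) ^ 2 / cstar) * (r * ℓ)) * cstar := by field_simp
      _ ≤ n * (θ * cstar) * cstar := by gcongr
      _ = _ := by ring
  have hB : 10 ^ 14 * (r * ℓ ^ 3) ≤ n * (θ * cstar) := by
    have h1 : 10 ^ 14 * (ℓ ^ 2) * (r * ℓ) / (θ * cstar) ≤ n :=
      le_trans (by gcongr; exact le_max_right _ _) h
    rw [div_le_iff₀ (by positivity)] at h1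
    linarith
  have hr3 : (r : ℝ) ^ 2 ≤ r ^ 3 := pow_le_pow_right₀ hr' (by norm_num)
  have hr1 : (r : ℝ) ≤ r ^ 3 := by nlinarith
  have hcc : cstar ^ 2 ≤ 1 := by nlinarith
  refine ⟨?_, ?_⟩
  · have h1 : (n : ℝ) * (θ * cstar ^ 2) ≤ n * 1 := by
      gcongr; nlinarith
    have h2 : (r : ℝ) * 0.69 ≤ r ^ 3 * ℓ := by gcongr
    have : (100 : ℝ) * r ≤ n := by nlinarith
    exact_mod_cast this
  · have e1 : √((r : ℝ) ^ 2 * ℓ / (θ * n)) ≤ cstar / 10 ^ 7 := by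
      refine sqrt_le_iff.mpr ⟨by positivity, ?_⟩
      rw [div_le_iff₀ (by positivity)]
      have : (r : ℝ) ^ 2 * ℓ ≤ r ^ 3 * ℓ := by gcongr
      calc (r : ℝ) ^ 2 * ℓ ≤ n * (θ * cstar ^ 2) / 10 ^ 14 := by
            rw [le_div_iff₀ (by norm_num)]; linarith
        _ = _ := by ring
    have e2 : θ * (r : ℝ) ^ 2 * (r * ℓ / n) ≤ cstar / 10 ^ 7 := by
      rw [← mul_div_assoc, div_le_div_iff₀ hn0 (by norm_num)]
      have h1 : θ * (10 ^ 14 * ((r : ℝ) ^ 3 * ℓ)) ≤ 1 * (n * (θ * cstar ^ 2)) := by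
        gcongr; linarith
      have h2 : (n : ℝ) * (θ * cstar ^ 2) ≤ n * cstar := by
        gcongr; nlinarith
      have h3 : 0 ≤ θ * ((r : ℝ) ^ 3 * ℓ) := by positivity
      nlinarith
    have e3 : ℓ ^ 2 / θ * (r * ℓ / n) ≤ cstar / 10 ^ 7 := by
      rw [div_mul_div_comm, div_le_div_iff₀ (by positivity) (by norm_num)]
      have h3 : 0 ≤ r * ℓ ^ 3 := by positivity
      nlinarith
    rw [criticalRate, add_mul]
    linarith

theorem stmt15 : ∃ C C'' c c' : ℝ, 0 < C ∧ 0 < C'' ∧ 0 < c ∧ 0 < c' ∧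
    ∀ (p r n : ℕ), 1 ≤ r → r ≤ p → 2 ≤ n →
    ∀ (θ cstar σ : ℝ), 0 < θ → θ ≤ 1/9 → 0 < cstar → cstar ≤ 1/4 → 0 < σ →
      C * max ((r:ℝ)^2/cstar) ((Real.log (n:ℝ))^2) * ((r:ℝ) * Real.log (n:ℝ))/(θ*cstar)
        ≤ (n:ℝ) →
    ∀ (A : Matrix (Fin p) (Fin r) ℝ), Aᵀ * A = 1 →
      bgMatrix r n θ (σ^2) {X | ¬ ∀ qb : Fin p → ℝ, l2sq qb = 1 →
          cstar < linfSq (zeta A qb) →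
          gradF θ σ A (Matrix.of X) qb = 0 →
          (∀ v : Fin p → ℝ, v ⬝ᵥ qb = 0 → 0 ≤ qform (hessF θ σ A (Matrix.of X) qb) v) →
          ∃ i : Fin r,
            l2sq (qb - fun k => A k i) ≤
              C'' * (Real.sqrt ((r:ℝ)^2 * Real.log (n:ℝ)/(θ*(n:ℝ)))
                + (θ*(r:ℝ)^2 + (Real.log (n:ℝ))^2/θ) * ((r:ℝ)*Real.log (n:ℝ)/(n:ℝ))) ∨
            l2sq (qb + fun k => A k i) ≤
              C'' * (Real.sqrt ((r:ℝ)^2 * Real.log (n:ℝ)/(θ*(n:ℝ)))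
                + (θ*(r:ℝ)^2 + (Real.log (n:ℝ))^2/θ) * ((r:ℝ)*Real.log (n:ℝ)/(n:ℝ)))}
      ≤ ENNReal.ofReal (c * (n:ℝ) ^ (-c')) := by
  refine ⟨10 ^ 14, 528000, 3, 2, by norm_num, by norm_num, by norm_num, by norm_num, ?_⟩
  intro p r n hr _ hn θ cstar σ hθ hθ1 hc hc1 hσ hN A hA
  obtain ⟨hrn, hrate⟩ := criticalRate_le_of_sampleSize hr hn hθ hθ1 hc hc1 hN
  have hdev := devRadius_le_criticalRate hr hn hθ
  have hdev0 : 0 ≤ devRadius r n θ := devRadius_nonneg hθ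
  have hrate0 : 0 ≤ criticalRate r n θ := by linarith
  set B : Set (Fin n → Fin r → ℝ) :=
    {Y | ¬ ∀ a, |quarticDev θ Y a| ≤ 3 * devRadius r n θ * (l2sq a) ^ 2} with hB
  have hprob := isProbabilityMeasure_bgVec r 1 hθ.le (by linarith : θ ≤ 1)
  have hmeas : Measurable fun (X : Fin r → Fin n → ℝ) k i => σ⁻¹ * X i k := by fun_prop
  calc _ ≤ bgMatrix r n θ (σ ^ 2) ((fun X k i => σ⁻¹ * X i k) ⁻¹' B) := by
        refine measure_mono fun X hX hgood => hX fun q hq hqc hg hh => ?_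
        obtain ⟨i, hi⟩ := exists_l2sq_sub_col_le hr (by omega) hθ hθ1 hσ
          (by positivity : 0 ≤ 3 * devRadius r n θ) (by linarith) hA hgood hq hqc hg hh
        have hfin : 16 * (3 * devRadius r n θ) ≤ 528000 * criticalRate r n θ := by linarith
        exact ⟨i, hi.imp (fun h => h.trans hfin) fun h => h.trans hfin⟩
    _ ≤ (bgMatrix r n θ (σ ^ 2)).map (fun X k i => σ⁻¹ * X i k) B :=
        Measure.le_map_apply hmeas.aemeasurable B
    _ = (Measure.pi fun _ : Fin n => bgVec r θ 1) B := by
        rw [map_bgMatrix hθ.le (by linarith) hσ]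
    _ = ENNReal.ofReal ((Measure.pi fun _ : Fin n => bgVec r θ 1).real B) :=
        (ofReal_measureReal).symm
    _ ≤ ENNReal.ofReal (3 * (n : ℝ) ^ (-2 : ℝ)) := by
        refine ENNReal.ofReal_le_ofReal ((measure_quarticDev_gt_le hr hn hrn hθ hθ1).trans_eq ?_)
        rw [Real.rpow_neg (by positivity), div_eq_mul_inv]
        norm_num

end
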